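/- arXiv:2603.16213 — 9 statements merged into one kernel-verified Lean document; each statement's English description precedes it below -/
import Mathlib

section
/- Let (X, A) and (Y, B) be measurable spaces. Let g : X × [0,∞) → [-∞,∞] be such that for every Δ ≥ 0 the map x ↦ g(x,Δ) is A-measurable, and for every x ∈ X the map Δ ↦ g(x,Δ) is non-decreasing. Let h : Y → [-∞,∞] be B-measurable, and define Δ̂(x,y) := inf{Δ ≥ 0 : g(x,Δ) ≥ h(y)} (with inf ∅ = ∞). Then the map (x,y) ↦ Δ̂(x,y) is measurable with respect to the product σ-algebra A ⊗ B. -/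
open MeasureTheory
open scoped ENNReal NNReal

/-- Lemma: measurability of inversion.
`g : X × [0,∞) → [-∞,∞]` is measurable in `x` for each `Δ ≥ 0` and non-decreasing in `Δ`
for each `x`; `h : Y → [-∞,∞]` is measurable.  Then
`Δ̂(x,y) := inf {Δ ≥ 0 : g(x,Δ) ≥ h(y)}` (with `inf ∅ = ∞`, as an element of `[0,∞]`)
is measurable for the product σ-algebra. -/
theorem stmt0 {X Y : Type*} [MeasurableSpace X] [MeasurableSpace Y]
    (g : X → ℝ≥0 → EReal) (h : Y → EReal)
    (hg_meas : ∀ Δ : ℝ≥0, Measurable fun x => g x Δ)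
    (hg_mono : ∀ x, Monotone (g x))
    (hh : Measurable h) :
    Measurable fun p : X × Y =>
      sInf {d : ℝ≥0∞ | ∃ Δ : ℝ≥0, (Δ : ℝ≥0∞) = d ∧ h p.2 ≤ g p.1 Δ} := by
  refine measurable_of_Iio fun a => ?_
  have key : (fun p : X × Y =>
      sInf {d : ℝ≥0∞ | ∃ Δ : ℝ≥0, (Δ : ℝ≥0∞) = d ∧ h p.2 ≤ g p.1 Δ}) ⁻¹' Set.Iio a =
      ⋃ q : ℚ, ⋃ _ : ((Real.toNNReal q : ℝ≥0) : ℝ≥0∞) < a,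
        {p : X × Y | h p.2 ≤ g p.1 (Real.toNNReal q)} := by
    ext p
    simp only [Set.mem_preimage, Set.mem_Iio, sInf_lt_iff, Set.mem_ofPred_eq, Set.mem_iUnion,
      exists_prop]
    constructor
    · rintro ⟨_, ⟨Δ, rfl, hΔ⟩, hlt⟩
      obtain ⟨q, -, hΔq, hqa⟩ := ENNReal.lt_iff_exists_rat_btwn.1 hlt
      exact ⟨q, hqa, hΔ.trans (hg_mono p.1 (ENNReal.coe_lt_coe.1 hΔq).le)⟩
    · rintro ⟨q, hqa, hq⟩
      exact ⟨_, ⟨_, rfl, hq⟩, hqa⟩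
  rw [key]
  exact MeasurableSet.iUnion fun q => MeasurableSet.iUnion fun _ =>
    measurableSet_le (hh.comp measurable_snd) ((hg_meas _).comp measurable_fst)
end

section
/- Let (P_μ)_{μ≥0} be a family of probability measures on a measurable space X. (i) If (x,α) ↦ Δ̂_α(x) is jointly measurable and α ↦ Δ̂_α(x) is non-increasing and right-continuous for every x, then ε_Δ(x) := sup{1/α : Δ ≥ Δ̂_α(x)} = 1/inf{α > 0 : Δ ≥ Δ̂_α(x)} defines a family of e-values, measurable in x for each Δ and non-decreasing right-continuous in Δ; the curve α ↦ Δ̂_α is uniformly valid (meaning sup_{Δ≥0} E_{P_Δ}[1{Δ ≥ Δ̂_{α̃}}/α̃] ≤ 1 for every measurable map α̃ : X → (0,∞)) if and only if every ε_Δ is a valid e-value for H_0^Δ = {P_μ : μ ≥ Δ}. (ii) Conversely, if (ε_Δ)_{Δ≥0} is a family of e-values, measurable in x, non-decreasing and right-continuous in Δ, then Δ̂_α(x) := inf{Δ ≥ 0 : ε_Δ(x) ≥ 1/α} is jointly measurable, non-increasing and right-continuous in α, and the same equivalence between uniform validity of the curve and validity of all ε_Δ holds. -/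
open MeasureTheory
open scoped ENNReal NNReal

theorem ENNReal.le_coe_of_forall_lt {a : ℝ≥0∞} {r : ℝ≥0}
    (h : ∀ s : ℝ≥0, r < s → a ≤ s) : a ≤ r := by
  by_contra hlt
  obtain ⟨s, hrs, hsa⟩ := ENNReal.lt_iff_exists_nnreal_btwn.1 (not_le.1 hlt)
  exact absurd (h s (ENNReal.coe_lt_coe.1 hrs)) (not_le.2 hsa)

theorem sInf_le_coe_iff {S : Set ℝ≥0∞} {p : ℝ≥0 → Prop}
    (mem_of_pos : ∀ r : ℝ≥0, 0 < r → p r → (r : ℝ≥0∞) ∈ S)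
    (exists_of_mem : ∀ d ∈ S, ∃ r : ℝ≥0, (r : ℝ≥0∞) = d ∧ p r)
    (mono : ∀ r s, r ≤ s → p r → p s)
    (right_closed : ∀ r, (∀ s, r < s → p s) → p r) (r : ℝ≥0) :
    sInf S ≤ r ↔ p r := by
  constructor
  · intro h
    refine right_closed r fun s hs => ?_
    obtain ⟨d, hd, hds⟩ := sInf_lt_iff.1 (h.trans_lt (ENNReal.coe_lt_coe.2 hs))
    obtain ⟨t, rfl, ht⟩ := exists_of_mem d hd
    exact mono t s (ENNReal.coe_lt_coe.1 hds).le ht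
  · intro h
    refine ENNReal.le_coe_of_forall_lt fun s hs => sInf_le ?_
    exact mem_of_pos s (pos_of_gt hs) (mono r s hs.le h)

theorem ENNReal.le_of_forall_le_coe {a b : ℝ≥0∞}
    (h : ∀ r : ℝ≥0, b ≤ r → a ≤ r) : a ≤ b := by
  cases b with
  | top => exact le_top
  | coe b => exact h b le_rfl

theorem ENNReal.measurable_of_measurableSet_le_coe {Y : Type*} [MeasurableSpace Y]
    {f : Y → ℝ≥0∞} (h : ∀ r : ℝ≥0, MeasurableSet {y | f y ≤ r}) : Measurable f := by
  refine measurable_of_Iic fun b => ?_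
  cases b with
  | top => simp
  | coe b => exact h b

/-- Validity at every measurable data-dependent level of the curve `D` amounts to validity of the
e-values `ε` linked to it by the Galois-type relation `D x α ≤ Δ ↔ α⁻¹ ≤ ε Δ x`. -/
theorem uniformlyValid_iff_valid {X : Type*} [MeasurableSpace X] (P : ℝ≥0 → Measure X)
    {D : X → ℝ≥0 → ℝ≥0∞} {ε : ℝ≥0 → X → ℝ≥0∞} (measurable_ε : ∀ Δ, Measurable (ε Δ))
    (mono_ε : ∀ x, Monotone fun Δ => ε Δ x)
    (le_iff : ∀ x α (Δ : ℝ≥0), D x α ≤ Δ ↔ ((α : ℝ≥0∞))⁻¹ ≤ ε Δ x) :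
    (∀ alev : X → ℝ≥0, Measurable alev → (∀ x, 0 < alev x) →
        ∀ Δ : ℝ≥0,
          ∫⁻ x, {y | D y (alev y) ≤ (Δ : ℝ≥0∞)}.indicator
            (fun y => ((alev y : ℝ≥0∞))⁻¹) x ∂(P Δ) ≤ 1) ↔
      (∀ Δ : ℝ≥0, ∀ μ, Δ ≤ μ → ∫⁻ x, ε Δ x ∂(P μ) ≤ 1) := by
  constructor
  · intro h Δ μ hΔ
    refine (lintegral_mono fun x => mono_ε x hΔ).trans ?_
    have iSup_min : ∀ x, ε μ x = ⨆ n : ℕ, min (ε μ x) ((n : ℝ≥0∞) + 1) := by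
      intro x
      refine le_antisymm (le_of_forall_lt fun c hc => ?_) (iSup_le fun n => min_le_left _ _)
      obtain ⟨n, hn⟩ := ENNReal.exists_nat_gt hc.ne_top
      exact lt_iSup_iff.2 ⟨n, lt_min hc (hn.trans_le le_self_add)⟩
    rw [lintegral_congr iSup_min, lintegral_iSup (fun n => (measurable_ε μ).min measurable_const)
      (fun m n hmn x => by dsimp only; gcongr)]
    refine iSup_le fun n => ?_
    set level : X → ℝ≥0 := fun x =>
      if ε μ x = 0 then 1 else ((min (ε μ x) ((n : ℝ≥0∞) + 1))⁻¹).toNNReal with hlevel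
    have min_ne_zero : ∀ x, ε μ x ≠ 0 → min (ε μ x) ((n : ℝ≥0∞) + 1) ≠ 0 := fun x hx =>
      (lt_min (pos_iff_ne_zero.2 hx) (by positivity)).ne'
    have min_ne_top : ∀ x, min (ε μ x) ((n : ℝ≥0∞) + 1) ≠ ⊤ := fun x =>
      ne_top_of_le_ne_top (by finiteness) (min_le_right _ _)
    have level_inv : ∀ x, ε μ x ≠ 0 →
        ((level x : ℝ≥0∞))⁻¹ = min (ε μ x) ((n : ℝ≥0∞) + 1) := by
      intro x hx
      rw [hlevel]
      simp only [if_neg hx]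
      rw [ENNReal.coe_toNNReal (ENNReal.inv_ne_top.2 (min_ne_zero x hx)), inv_inv]
    refine (lintegral_mono fun x => ?_).trans (h level ?_ ?_ μ)
    · by_cases hx : ε μ x = 0
      · simp [hx]
      · have hmem : x ∈ {y | D y (level y) ≤ (μ : ℝ≥0∞)} :=
          (le_iff x _ μ).2 ((level_inv x hx).trans_le (min_le_left _ _))
        rw [Set.indicator_of_mem hmem, level_inv x hx]
    · exact Measurable.ite (measurable_ε μ (measurableSet_singleton 0)) measurable_const
        ((measurable_ε μ).min measurable_const).inv.ennreal_toNNReal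
    · intro x
      by_cases hx : ε μ x = 0
      · simp [hlevel, hx]
      · simp only [hlevel, if_neg hx]
        exact ENNReal.toNNReal_pos (ENNReal.inv_ne_zero.2 (min_ne_top x))
          (ENNReal.inv_ne_top.2 (min_ne_zero x hx))
  · intro h level _ _ Δ
    refine (lintegral_mono fun x => ?_).trans (h Δ Δ le_rfl)
    exact Set.indicator_le (fun y hy => (le_iff y _ Δ).1 hy) x

/-- Theorem: uniformly valid equivalence curves ↔ curves of e-values.
Model `(P_μ)_{μ ≥ 0}`.
(i) A jointly measurable equivalence curve `(x,α) ↦ Δ̂_α(x)`, non-increasing and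
right-continuous in `α`, induces through
`ε_Δ(x) = 1 / inf {α > 0 : Δ ≥ Δ̂_α(x)}` a family of e-values, measurable in `x`,
non-decreasing and right-continuous in `Δ`; the curve is uniformly valid
(i.e. `E_{P_Δ}[1{Δ ≥ Δ̂_{α̃}}/α̃] ≤ 1` for every measurable data-dependent level `α̃ > 0`
and every `Δ`) iff every `ε_Δ` is a valid e-value for `H₀^Δ = {P_μ : μ ≥ Δ}`.
(ii) Conversely a family of e-values, measurable in `x`, non-decreasing and
right-continuous in `Δ`, yields through `Δ̂_α(x) = inf {Δ : ε_Δ(x) ≥ 1/α}` a jointly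
measurable curve, non-increasing and right-continuous in `α`, with the same equivalence
between uniform validity and validity of all of the `ε_Δ`. -/
theorem stmt2 {X : Type*} [MeasurableSpace X]
    (P : ℝ≥0 → Measure X) (hP : ∀ μ, IsProbabilityMeasure (P μ)) :
    (∀ D : X → ℝ≥0 → ℝ≥0∞,
      Measurable (fun p : X × ℝ≥0 => D p.1 p.2) →
      (∀ x, Antitone (D x)) →
      (∀ x α, D x α = ⨆ α' ∈ Set.Ioi α, D x α') →
      let ε : ℝ≥0 → X → ℝ≥0∞ := fun Δ x =>
        (sInf {a : ℝ≥0∞ | ∃ α : ℝ≥0, 0 < α ∧ (α : ℝ≥0∞) = a ∧ D x α ≤ (Δ : ℝ≥0∞)})⁻¹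
      (∀ Δ, Measurable (ε Δ)) ∧
      (∀ x, Monotone fun Δ => ε Δ x) ∧
      (∀ x Δ, ε Δ x = ⨅ Δ' ∈ Set.Ioi Δ, ε Δ' x) ∧
      ((∀ alev : X → ℝ≥0, Measurable alev → (∀ x, 0 < alev x) →
          ∀ Δ : ℝ≥0,
            ∫⁻ x, {y | D y (alev y) ≤ (Δ : ℝ≥0∞)}.indicator
              (fun y => ((alev y : ℝ≥0∞))⁻¹) x ∂(P Δ) ≤ 1) ↔
        (∀ Δ : ℝ≥0, ∀ μ, Δ ≤ μ → ∫⁻ x, ε Δ x ∂(P μ) ≤ 1)))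
    ∧
    (∀ ε : ℝ≥0 → X → ℝ≥0∞,
      (∀ Δ, Measurable (ε Δ)) →
      (∀ x, Monotone fun Δ => ε Δ x) →
      (∀ x Δ, ε Δ x = ⨅ Δ' ∈ Set.Ioi Δ, ε Δ' x) →
      let D : X → ℝ≥0 → ℝ≥0∞ := fun x α =>
        sInf {d : ℝ≥0∞ | ∃ Δ : ℝ≥0, (Δ : ℝ≥0∞) = d ∧ ((α : ℝ≥0∞))⁻¹ ≤ ε Δ x}
      Measurable (fun p : X × ℝ≥0 => D p.1 p.2) ∧
      (∀ x, Antitone (D x)) ∧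
      (∀ x α, D x α = ⨆ α' ∈ Set.Ioi α, D x α') ∧
      ((∀ alev : X → ℝ≥0, Measurable alev → (∀ x, 0 < alev x) →
          ∀ Δ : ℝ≥0,
            ∫⁻ x, {y | D y (alev y) ≤ (Δ : ℝ≥0∞)}.indicator
              (fun y => ((alev y : ℝ≥0∞))⁻¹) x ∂(P Δ) ≤ 1) ↔
        (∀ Δ : ℝ≥0, ∀ μ, Δ ≤ μ → ∫⁻ x, ε Δ x ∂(P μ) ≤ 1))) := by
  constructor
  · intro D measurable_D anti_D right_D ε
    have sInf_le_iff : ∀ x (α Δ : ℝ≥0),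
        sInf {a : ℝ≥0∞ | ∃ α : ℝ≥0, 0 < α ∧ (α : ℝ≥0∞) = a ∧ D x α ≤ (Δ : ℝ≥0∞)} ≤ α ↔
          D x α ≤ Δ := by
      intro x α Δ
      refine sInf_le_coe_iff (p := fun α => D x α ≤ Δ) ?_ ?_
        (fun r s hrs hr => (anti_D x hrs).trans hr) ?_ α
      · exact fun r hr hp => ⟨r, hr, rfl, hp⟩
      · rintro d ⟨r, -, hr, hp⟩
        exact ⟨r, hr, hp⟩
      · intro r hr
        rw [right_D]
        exact iSup₂_le hr
    have le_iff : ∀ x α (Δ : ℝ≥0), D x α ≤ Δ ↔ ((α : ℝ≥0∞))⁻¹ ≤ ε Δ x := by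
      intro x α Δ
      rw [ENNReal.inv_le_inv, sInf_le_iff]
    have measurable_ε : ∀ Δ, Measurable (ε Δ) := by
      intro Δ
      refine Measurable.inv (ENNReal.measurable_of_measurableSet_le_coe fun r => ?_)
      simp only [sInf_le_iff]
      exact measurableSet_le (measurable_D.comp measurable_prodMk_right) measurable_const
    have mono_ε : ∀ x, Monotone fun Δ => ε Δ x := by
      intro x Δ Δ' hΔ
      refine ENNReal.inv_le_inv.2 (sInf_le_sInf ?_)
      rintro a ⟨α, hα, rfl, h⟩
      exact ⟨α, hα, rfl, h.trans (by exact_mod_cast hΔ)⟩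
    refine ⟨measurable_ε, mono_ε, fun x Δ => ?_, uniformlyValid_iff_valid P measurable_ε mono_ε le_iff⟩
    refine le_antisymm (le_iInf₂ fun Δ' hΔ' => mono_ε x (Set.mem_Ioi.1 hΔ').le) ?_
    refine ENNReal.le_inv_iff_le_inv.2 (ENNReal.le_of_forall_le_coe fun r hr => ?_)
    rw [sInf_le_iff]
    refine ENNReal.le_coe_of_forall_lt fun Δ' hΔ' => ?_
    rw [le_iff]
    exact (ENNReal.inv_le_iff_inv_le.1 hr).trans (iInf₂_le Δ' hΔ')
  · intro ε measurable_ε mono_ε right_ε D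
    have le_iff : ∀ x α (Δ : ℝ≥0), D x α ≤ Δ ↔ ((α : ℝ≥0∞))⁻¹ ≤ ε Δ x := by
      intro x α Δ
      refine sInf_le_coe_iff (p := fun Δ => ((α : ℝ≥0∞))⁻¹ ≤ ε Δ x) ?_
        (fun d hd => hd) (fun r s hrs hr => hr.trans (mono_ε x hrs)) ?_ Δ
      · exact fun r _ hp => ⟨r, rfl, hp⟩
      · intro r hr
        rw [right_ε]
        exact le_iInf₂ hr
    have anti_D : ∀ x, Antitone (D x) := by
      intro x α α' hα
      refine ENNReal.le_of_forall_le_coe fun r hr => ?_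
      rw [le_iff] at hr ⊢
      exact (ENNReal.inv_le_inv.2 (by exact_mod_cast hα)).trans hr
    refine ⟨ENNReal.measurable_of_measurableSet_le_coe fun r => ?_, anti_D, fun x α => ?_,
      uniformlyValid_iff_valid P measurable_ε mono_ε le_iff⟩
    · simp only [le_iff]
      exact measurableSet_le measurable_snd.coe_nnreal_ennreal.inv
        ((measurable_ε r).comp measurable_fst)
    · refine le_antisymm (ENNReal.le_of_forall_le_coe fun r hr => ?_)
        (iSup₂_le fun α' hα' => anti_D x (Set.mem_Ioi.1 hα').le)
      rw [le_iff, ENNReal.inv_le_iff_inv_le]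
      refine ENNReal.le_coe_of_forall_lt fun α' hα' => ?_
      rw [ENNReal.inv_le_iff_inv_le, ← le_iff]
      exact (le_iSup₂ (f := fun α' (_ : α' ∈ Set.Ioi α) => D x α') α' hα').trans hr
end

section
/- Let ε^1_Δ(x) and ε^2_Δ(x) be two families of nonnegative functions on X, each non-decreasing and right-continuous in Δ ≥ 0, with associated equivalence curves Δ̂^j_α(x) := inf{Δ ≥ 0 : ε^j_Δ(x) ≥ 1/α} for j = 1,2. Then for every x and every α > 0, the equivalence curve obtained by inverting the product, Δ̂^×_α(x) := inf{Δ ≥ 0 : ε^1_Δ(x)·ε^2_Δ(x) ≥ 1/α}, satisfies Δ̂^×_α(x) = inf over all α₁, α₂ > 0 with α₁α₂ = α of max{Δ̂^1_{α₁}(x), Δ̂^2_{α₂}(x)}. -/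
open scoped ENNReal NNReal

/-- The inverted equivalence curve of a family `Δ ↦ ε_Δ` of nonnegative ([0,∞]-valued)
functions: `Δ̂_α(x) := inf {Δ ≥ 0 : ε_Δ(x) ≥ 1/α}`, with `inf ∅ = ∞`, viewed as an
element of `[0,∞]`. -/
noncomputable def invCurve {X : Type*} (ε : ℝ≥0 → X → ℝ≥0∞) (α : ℝ≥0) (x : X) : ℝ≥0∞ :=
  sInf {d : ℝ≥0∞ | ∃ Δ : ℝ≥0, (Δ : ℝ≥0∞) = d ∧ ((α : ℝ≥0∞))⁻¹ ≤ ε Δ x}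

theorem invCurve_le {X : Type*} {ε : ℝ≥0 → X → ℝ≥0∞} {α : ℝ≥0} {x : X} {Δ : ℝ≥0}
    (h : (α : ℝ≥0∞)⁻¹ ≤ ε Δ x) : invCurve ε α x ≤ Δ :=
  sInf_le ⟨Δ, rfl, h⟩

theorem inv_le_of_invCurve_lt {X : Type*} {ε : ℝ≥0 → X → ℝ≥0∞} {α : ℝ≥0} {x : X} {D : ℝ≥0}
    (hmono : Monotone fun Δ => ε Δ x) (h : invCurve ε α x < D) : (α : ℝ≥0∞)⁻¹ ≤ ε D x := by
  obtain ⟨_, ⟨Δ, rfl, hΔ⟩, hlt⟩ := sInf_lt_iff.1 h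
  exact hΔ.trans (hmono (ENNReal.coe_lt_coe.1 hlt).le)

theorem exists_mul_eq_inv_le_of_ne_top {α : ℝ≥0} (hα : 0 < α) {a b : ℝ≥0∞}
    (h : (α : ℝ≥0∞)⁻¹ ≤ a * b) (ha : a ≠ ∞) :
    ∃ α₁ α₂ : ℝ≥0, 0 < α₁ ∧ 0 < α₂ ∧ α₁ * α₂ = α ∧
      (α₁ : ℝ≥0∞)⁻¹ ≤ a ∧ (α₂ : ℝ≥0∞)⁻¹ ≤ b := by
  lift a to ℝ≥0 using ha
  have ha0 : a ≠ 0 := by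
    rintro rfl
    simp at h
  refine ⟨a⁻¹, a * α, by positivity, by positivity, by field_simp, ?_, ?_⟩
  · rw [ENNReal.coe_inv ha0, inv_inv]
  · have ha' : (a : ℝ≥0∞) ≠ 0 := by simpa using ha0
    rw [ENNReal.coe_mul, ENNReal.mul_inv (Or.inl ha') (Or.inl ENNReal.coe_ne_top)]
    calc (a : ℝ≥0∞)⁻¹ * (α : ℝ≥0∞)⁻¹ ≤ (a : ℝ≥0∞)⁻¹ * (a * b) := by gcongr
      _ = b := by rw [← mul_assoc, ENNReal.inv_mul_cancel ha' ENNReal.coe_ne_top, one_mul]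

theorem exists_mul_eq_inv_le {α : ℝ≥0} (hα : 0 < α) {a b : ℝ≥0∞}
    (h : (α : ℝ≥0∞)⁻¹ ≤ a * b) :
    ∃ α₁ α₂ : ℝ≥0, 0 < α₁ ∧ 0 < α₂ ∧ α₁ * α₂ = α ∧
      (α₁ : ℝ≥0∞)⁻¹ ≤ a ∧ (α₂ : ℝ≥0∞)⁻¹ ≤ b := by
  by_cases ha : a = ∞
  · by_cases hb : b = ∞
    · exact ⟨1, α, one_pos, hα, one_mul α, by simp [ha], by simp [hb]⟩
    · obtain ⟨α₂, α₁, h₂, h₁, hmul, hb', ha'⟩ :=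
        exists_mul_eq_inv_le_of_ne_top hα (mul_comm a b ▸ h) hb
      exact ⟨α₁, α₂, h₁, h₂, mul_comm α₁ α₂ ▸ hmul, ha', hb'⟩
  · exact exists_mul_eq_inv_le_of_ne_top hα h ha

/-- merging by multiplication.  For two families `ε¹, ε²` of nonnegative
functions, non-decreasing and right-continuous in `Δ`, the curve obtained by inverting the
product `Δ ↦ ε¹_Δ · ε²_Δ` at level `α > 0` equals the infimum over all `α₁, α₂ > 0` with
`α₁·α₂ = α` of `max {Δ̂¹_{α₁}, Δ̂²_{α₂}}`. -/
theorem stmt3 {X : Type*} (ε1 ε2 : ℝ≥0 → X → ℝ≥0∞)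
    (h1mono : ∀ x, Monotone fun Δ => ε1 Δ x)
    (h1rc : ∀ x Δ, ε1 Δ x = ⨅ Δ' ∈ Set.Ioi Δ, ε1 Δ' x)
    (h2mono : ∀ x, Monotone fun Δ => ε2 Δ x)
    (h2rc : ∀ x Δ, ε2 Δ x = ⨅ Δ' ∈ Set.Ioi Δ, ε2 Δ' x)
    (x : X) (α : ℝ≥0) (hα : 0 < α) :
    invCurve (fun Δ y => ε1 Δ y * ε2 Δ y) α x =
      sInf {d : ℝ≥0∞ | ∃ α₁ α₂ : ℝ≥0, 0 < α₁ ∧ 0 < α₂ ∧ α₁ * α₂ = α ∧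
        d = max (invCurve ε1 α₁ x) (invCurve ε2 α₂ x)} := by
  apply le_antisymm
  · apply le_sInf
    rintro _ ⟨α₁, α₂, hα₁, hα₂, rfl, rfl⟩
    refine ENNReal.le_of_forall_pos_le_add fun δ hδ hfin => ?_
    generalize hd : max (invCurve ε1 α₁ x) (invCurve ε2 α₂ x) = d at hfin
    lift d to ℝ≥0 using hfin.ne
    have hlt : (d : ℝ≥0∞) < (d + δ : ℝ≥0) :=
      ENNReal.coe_lt_coe.2 (lt_add_of_pos_right d hδ)
    rw [← ENNReal.coe_add]
    apply invCurve_le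
    rw [ENNReal.coe_mul, ENNReal.mul_inv (Or.inr ENNReal.coe_ne_top) (Or.inl ENNReal.coe_ne_top)]
    exact mul_le_mul'
      (inv_le_of_invCurve_lt (h1mono x) (((le_max_left _ _).trans hd.le).trans_lt hlt))
      (inv_le_of_invCurve_lt (h2mono x) (((le_max_right _ _).trans hd.le).trans_lt hlt))
  · apply le_sInf
    rintro _ ⟨Δ, rfl, hΔ⟩
    obtain ⟨α₁, α₂, h₁, h₂, hmul, ha, hb⟩ := exists_mul_eq_inv_le hα hΔ
    exact sInf_le_of_le ⟨α₁, α₂, h₁, h₂, hmul, rfl⟩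
      (max_le (invCurve_le ha) (invCurve_le hb))
end

section
/- Let (P_μ)_{μ≥0} be a family of probability measures on X, let D be a decision space, and let L_μ : D → [0,∞) be a loss function that is non-decreasing in μ for every fixed d ∈ D. If Δ̂_α : X → [0,∞] is a valid data-dependent margin at level α (i.e. sup_{Δ≥0} P_Δ(Δ ≥ Δ̂_α) ≤ α), then for every measurable data-dependent decision d̂ : X → D, sup_{μ≥0} P_μ( L_μ(d̂) > L_{Δ̂_α}(d̂) ) ≤ α. -/
open MeasureTheory
open scoped ENNReal NNReal

/-- uniform loss bound, Theorem `evidence-informed decision`.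
Model `(P_μ)_{μ ≥ 0}`, decision space `𝒟`, loss `L_μ : 𝒟 → [0,∞)` non-decreasing in `μ`.
If the data-dependent margin `Δ̂_α : X → [0,∞]` is valid at level `α`, i.e.
`P_Δ(Δ ≥ Δ̂_α) ≤ α` for every `Δ ≥ 0`, then for every measurable data-dependent decision
`d̂ : X → 𝒟` we have `P_μ(L_μ(d̂) > L_{Δ̂_α}(d̂)) ≤ α` for every `μ ≥ 0`. -/
theorem stmt5 {X 𝒟 : Type*} [MeasurableSpace X] [MeasurableSpace 𝒟]
    (P : ℝ≥0 → Measure X) (hP : ∀ μ, IsProbabilityMeasure (P μ))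
    (L : ℝ≥0∞ → 𝒟 → ℝ)
    (hL_nonneg : ∀ μ d, 0 ≤ L μ d)
    (hL_mono : ∀ d, Monotone fun μ => L μ d)
    (α : ℝ≥0∞)
    (Dhat : X → ℝ≥0∞) (hDhat : Measurable Dhat)
    (hvalid : ∀ Δ : ℝ≥0, P Δ {x | Dhat x ≤ (Δ : ℝ≥0∞)} ≤ α)
    (dec : X → 𝒟) (hdec : Measurable dec) :
    ∀ μ : ℝ≥0, P μ {x | L (Dhat x) (dec x) < L (μ : ℝ≥0∞) (dec x)} ≤ α := by
  exact fun μ => (measure_mono fun x hx =>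
    ((hL_mono (dec x)).reflect_lt hx).le).trans (hvalid μ)
end

section
/- Let (P_μ)_{μ≥0} be a family of probability measures on X, let D be a decision space, and let L_μ : D → [0,∞) be a loss function that is non-decreasing in μ for every fixed d ∈ D. If (x,α) ↦ Δ̂_α(x) is a uniformly valid equivalence curve (meaning sup_{Δ≥0} E_{P_Δ}[1{Δ ≥ Δ̂_{α̃}}/α̃] ≤ 1 for every measurable α̃ : X → (0,∞)), then for every measurable data-dependent decision d̂ : X → D and every measurable data-dependent level α̃ : X → (0,∞), sup_{μ≥0} E_{P_μ}[ 1{ L_μ(d̂) > L_{Δ̂_{α̃}}(d̂) } / α̃ ] ≤ 1. -/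
open MeasureTheory
open scoped ENNReal NNReal

/-- post-hoc loss bound from a uniformly valid equivalence curve.
Model `(P_μ)_{μ ≥ 0}`, decision space `𝒟`, loss `L_μ : 𝒟 → [0,∞)` non-decreasing in `μ`.
If `(x,α) ↦ Δ̂_α(x)` is a uniformly valid equivalence curve, i.e.
`E_{P_Δ}[1{Δ ≥ Δ̂_{α̃}}/α̃] ≤ 1` for every `Δ ≥ 0` and every measurable `α̃ : X → (0,∞)`,
then for every measurable data-dependent decision `d̂` and every measurable data-dependent
level `α̃`, `sup_{μ ≥ 0} E_{P_μ}[1{L_μ(d̂) > L_{Δ̂_{α̃}}(d̂)}/α̃] ≤ 1`. -/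
theorem stmt6 {X 𝒟 : Type*} [MeasurableSpace X] [MeasurableSpace 𝒟]
    (P : ℝ≥0 → Measure X) (hP : ∀ μ, IsProbabilityMeasure (P μ))
    (L : ℝ≥0∞ → 𝒟 → ℝ)
    (hL_nonneg : ∀ μ d, 0 ≤ L μ d)
    (hL_mono : ∀ d, Monotone fun μ => L μ d)
    (Dc : X → ℝ≥0 → ℝ≥0∞)
    (hDc_meas : Measurable (fun p : X × ℝ≥0 => Dc p.1 p.2))
    (hDc_anti : ∀ x, Antitone (Dc x))
    (hvalid : ∀ alev : X → ℝ≥0, Measurable alev → (∀ x, 0 < alev x) →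
      ∀ Δ : ℝ≥0,
        ∫⁻ x, {y | Dc y (alev y) ≤ (Δ : ℝ≥0∞)}.indicator
          (fun y => ((alev y : ℝ≥0∞))⁻¹) x ∂(P Δ) ≤ 1)
    (dec : X → 𝒟) (hdec : Measurable dec)
    (alev : X → ℝ≥0) (halev : Measurable alev) (halev_pos : ∀ x, 0 < alev x) :
    ∀ μ : ℝ≥0,
      ∫⁻ x, {y | L (Dc y (alev y)) (dec y) < L (μ : ℝ≥0∞) (dec y)}.indicator
        (fun y => ((alev y : ℝ≥0∞))⁻¹) x ∂(P μ) ≤ 1 := by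
  intro μ
  refine (lintegral_mono fun x => ?_).trans (hvalid alev halev halev_pos μ)
  refine Set.indicator_le_indicator_of_subset (fun y hy => ?_) (fun _ => zero_le) x
  exact ((hL_mono (dec y)).reflect_lt hy).le
end

section
/- In the STP₃ setting with boundaries Δ⁻ < Δ⁺, mixture alternative density q, utility U increasing, strictly concave, continuously differentiable with lim_{x→∞}U′(x)=0 and x·U′(x) bounded, ψ := (U′)⁻¹, and ε_{c,λ}(x) := ψ(λ·(c·p_{Δ⁻}(x)+(1−c)·p_{Δ⁺}(x))/q(x)): there exists (c*, λ*) ∈ (0,1) × (0,∞) such that E_{P_{Δ⁻}}[ε_{c*,λ*}(X)] = 1 and E_{P_{Δ⁺}}[ε_{c*,λ*}(X)] = 1. -/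
open MeasureTheory Set
open scoped ENNReal NNReal

/-- A family of strictly positive densities `p : M → X → ℝ` on totally ordered spaces is
strictly totally positive of order 3 (STP₃): all values are positive, and all `2×2` and
`3×3` determinants at increasing parameters and increasing sample points are positive. -/
def IsSTP3 {M X : Type*} [LinearOrder M] [LinearOrder X] (p : M → X → ℝ) : Prop :=
  (∀ μ x, 0 < p μ x) ∧
  (∀ μ₁ μ₂ : M, ∀ x₁ x₂ : X, μ₁ < μ₂ → x₁ < x₂ →
    0 < p μ₁ x₁ * p μ₂ x₂ - p μ₁ x₂ * p μ₂ x₁) ∧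
  (∀ μ₁ μ₂ μ₃ : M, ∀ x₁ x₂ x₃ : X, μ₁ < μ₂ → μ₂ < μ₃ → x₁ < x₂ → x₂ < x₃ →
    0 < Matrix.det !![p μ₁ x₁, p μ₁ x₂, p μ₁ x₃;
                      p μ₂ x₁, p μ₂ x₂, p μ₂ x₃;
                      p μ₃ x₁, p μ₃ x₂, p μ₃ x₃])

open Filter Topology

/-- The properties of the inverse `ψ` of a marginal utility on the positive half-line. -/
structure IsInverseMarginal (ψ : ℝ → ℝ) (C : ℝ) : Prop where
  measurable : Measurable ψ
  pos : ∀ y, 0 < y → 0 < ψ y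
  strictAntiOn : StrictAntiOn ψ (Ioi 0)
  continuousOn : ContinuousOn ψ (Ioi 0)
  le_div : ∀ y, 0 < y → ψ y ≤ C / y
  surj : ∀ t, 0 < t → ∃ y, 0 < y ∧ ψ y = t

/-- The convex combination of two densities. -/
def mixDensity {X : Type*} (f g : X → ℝ) (c : ℝ) (x : X) : ℝ := c * f x + (1 - c) * g x

/-- A continuous function of `(c, l)` strictly decreasing in `l` has a continuous level curve. -/
lemma exists_continuousOn_level {K : Set ℝ} {h : ℝ → ℝ → ℝ}
    (hcont : ContinuousOn (fun z : ℝ × ℝ => h z.1 z.2) (K ×ˢ Ioi 0))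
    (hanti : ∀ c ∈ K, StrictAntiOn (h c) (Ioi 0))
    (hle : ∀ c ∈ K, ∃ l, 0 < l ∧ h c l ≤ 1) (hge : ∀ c ∈ K, ∃ l, 0 < l ∧ 1 ≤ h c l) :
    ∃ L : ℝ → ℝ, ContinuousOn L K ∧ ∀ c ∈ K, 0 < L c ∧ h c (L c) = 1 := by
  have hex : ∀ c ∈ K, ∃ l, 0 < l ∧ h c l = 1 := by
    intro c hc
    obtain ⟨a, ha, ha1⟩ := hle c hc
    obtain ⟨b, hb, hb1⟩ := hge c hc
    have hsec : ContinuousOn (h c) (Ioi 0) :=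
      hcont.comp (f := fun l => (c, l)) (by fun_prop) (fun l hl => ⟨hc, hl⟩)
    obtain ⟨l, hl, hl1⟩ := isPreconnected_Ioi.intermediate_value ha hb hsec ⟨ha1, hb1⟩
    exact ⟨l, hl, hl1⟩
  choose! L hL using hex
  refine ⟨L, ?_, hL⟩
  intro c hc
  have hsec : ∀ l, 0 < l → ContinuousWithinAt (fun c => h c l) K c := fun l hl =>
    (hcont.comp (f := fun c => (c, l)) (by fun_prop) (fun c hc => ⟨hc, hl⟩)) c hc
  obtain ⟨hpos, heq⟩ := hL c hc
  refine tendsto_order.2 ⟨fun a ha => ?_, fun b hb => ?_⟩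
  · rcases le_or_gt a 0 with ha0 | ha0
    · filter_upwards [self_mem_nhdsWithin] with d hd using ha0.trans_lt (hL d hd).1
    · have h1 : 1 < h c a := heq ▸ hanti c hc ha0 hpos ha
      filter_upwards [self_mem_nhdsWithin, (hsec a ha0).eventually (lt_mem_nhds h1)] with d hd hd1
      by_contra! hcon
      have := (hanti d hd).antitoneOn (hL d hd).1 ha0 hcon
      linarith [(hL d hd).2]
  · have hb0 : 0 < b := hpos.trans hb
    have h1 : h c b < 1 := heq ▸ hanti c hc hpos hb0 hb
    filter_upwards [self_mem_nhdsWithin, (hsec b hb0).eventually (gt_mem_nhds h1)] with d hd hd1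
    by_contra! hcon
    have := (hanti d hd).antitoneOn hb0 (hL d hd).1 hcon
    linarith [(hL d hd).2]

section Calibration

variable {X : Type*} {ψ : ℝ → ℝ} {C : ℝ} {f g q : X → ℝ}

lemma mixDensity_pos (hf : ∀ x, 0 < f x) (hg : ∀ x, 0 < g x) {c : ℝ} (hc : c ∈ Icc (0 : ℝ) 1)
    (x : X) : 0 < mixDensity f g c x := by
  unfold mixDensity
  rcases hc.1.eq_or_lt with h | h
  · simpa [← h] using hg x
  · have := mul_pos h (hf x)
    have := mul_nonneg (sub_nonneg.2 hc.2) (hg x).le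
    linarith

lemma IsInverseMarginal.mul_le (hψ : IsInverseMarginal ψ C) (hq : ∀ x, 0 < q x) {r u : X → ℝ}
    (hr : ∀ x, 0 < r x) {A l : ℝ} (hl : 0 < l) {x : X} (hu0 : 0 ≤ u x) (hu : u x ≤ A * r x) :
    ‖ψ (l * r x / q x) * u x‖ ≤ C * A / l * q x := by
  have hy : 0 < l * r x / q x := div_pos (mul_pos hl (hr x)) (hq x)
  have h1 := hψ.le_div _ hy
  have h0 := hψ.pos _ hy
  rw [Real.norm_of_nonneg (mul_nonneg h0.le hu0)]
  calc ψ (l * r x / q x) * u x ≤ C / (l * r x / q x) * (A * r x) :=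
        mul_le_mul h1 hu hu0 (h0.le.trans h1)
    _ = C * A / l * q x := by
        have := (hr x).ne'; have := (hq x).ne'
        field_simp

variable [MeasurableSpace X] {ν : Measure X}

lemma measurable_mixDensity (hf : Measurable f) (hg : Measurable g) (c : ℝ) :
    Measurable (mixDensity f g c) := by
  unfold mixDensity; fun_prop

lemma IsInverseMarginal.measurable_comp (hψ : IsInverseMarginal ψ C) (hqm : Measurable q)
    {r u : X → ℝ} (hrm : Measurable r) (hum : Measurable u) (l : ℝ) :
    Measurable fun x => ψ (l * r x / q x) * u x :=
  (hψ.measurable.comp ((hrm.const_mul l).div hqm)).mul hum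

lemma IsInverseMarginal.integrable (hψ : IsInverseMarginal ψ C) (hq : ∀ x, 0 < q x)
    (hqm : Measurable q) (hqi : Integrable q ν) {r u : X → ℝ} (hr : ∀ x, 0 < r x)
    (hrm : Measurable r) (hum : Measurable u) {A l : ℝ} (hl : 0 < l) (hu0 : ∀ x, 0 ≤ u x)
    (hu : ∀ x, u x ≤ A * r x) : Integrable (fun x => ψ (l * r x / q x) * u x) ν :=
  (hqi.const_mul (C * A / l)).mono' (hψ.measurable_comp hqm hrm hum l).aestronglyMeasurable
    (ae_of_all _ fun x => hψ.mul_le hq hr hl (hu0 x) (hu x))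

lemma IsInverseMarginal.const_nonneg (hψ : IsInverseMarginal ψ C) : 0 ≤ C := by
  have := (hψ.pos 1 one_pos).le.trans (hψ.le_div 1 one_pos)
  simpa using this

lemma IsInverseMarginal.continuousOn_integral (hψ : IsInverseMarginal ψ C) (hq : ∀ x, 0 < q x)
    (hqm : Measurable q) (hqi : Integrable q ν) (hf : ∀ x, 0 < f x) (hg : ∀ x, 0 < g x)
    (hfm : Measurable f) (hgm : Measurable g) {K : Set ℝ} (hK : K ⊆ Icc 0 1)
    {u : ℝ → X → ℝ} (hum : ∀ c, Measurable (u c)) (huc : ∀ x, Continuous fun c => u c x)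
    {A : ℝ} (hA : 0 ≤ A) (hu0 : ∀ c ∈ K, ∀ x, 0 ≤ u c x)
    (hu : ∀ c ∈ K, ∀ x, u c x ≤ A * mixDensity f g c x) :
    ContinuousOn (fun z : ℝ × ℝ => ∫ x, ψ (z.2 * mixDensity f g z.1 x / q x) * u z.1 x ∂ν)
      (K ×ˢ Ioi 0) := by
  rintro ⟨c, l⟩ ⟨hc, hl⟩
  have hl : 0 < l := hl
  refine continuousWithinAt_of_dominated (bound := fun x => C * A / (l / 2) * q x) ?_ ?_
    (hqi.const_mul _) ?_
  · exact Eventually.of_forall fun z => (hψ.measurable_comp hqm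
      (measurable_mixDensity hfm hgm _) (hum _) _).aestronglyMeasurable
  · have hlt : ∀ᶠ z : ℝ × ℝ in 𝓝[K ×ˢ Ioi 0] (c, l), l / 2 < z.2 :=
      (continuous_snd.tendsto (c, l)).mono_left nhdsWithin_le_nhds
        |>.eventually (lt_mem_nhds (half_lt_self hl))
    filter_upwards [self_mem_nhdsWithin, hlt] with z hz hzl
    refine ae_of_all _ fun x => (hψ.mul_le hq (mixDensity_pos hf hg (hK hz.1)) hz.2
      (hu0 _ hz.1 x) (hu _ hz.1 x)).trans ?_
    have := hψ.const_nonneg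
    have := (hq x).le
    gcongr
  · refine ae_of_all _ fun x => ?_
    refine ContinuousWithinAt.mul ?_ (by fun_prop)
    have hy : 0 < l * mixDensity f g c x / q x :=
      div_pos (mul_pos hl (mixDensity_pos hf hg (hK hc) x)) (hq x)
    refine ContinuousAt.comp_continuousWithinAt
      (f := fun z : ℝ × ℝ => z.2 * mixDensity f g z.1 x / q x)
      (hψ.continuousOn.continuousAt (Ioi_mem_nhds hy)) ?_
    unfold mixDensity
    fun_prop

lemma IsInverseMarginal.strictAntiOn_integral (hψ : IsInverseMarginal ψ C) (hν : ν ≠ 0)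
    (hq : ∀ x, 0 < q x) (hqm : Measurable q) (hqi : Integrable q ν) {r : X → ℝ}
    (hr : ∀ x, 0 < r x) (hrm : Measurable r) :
    StrictAntiOn (fun l => ∫ x, ψ (l * r x / q x) * r x ∂ν) (Ioi 0) := by
  intro a ha b hb hab
  have ha : 0 < a := ha
  have hb : 0 < b := hb
  have hint : ∀ l, 0 < l → Integrable (fun x => ψ (l * r x / q x) * r x) ν := fun l hl =>
    hψ.integrable (A := 1) hq hqm hqi hr hrm hrm hl (fun x => (hr x).le) (by simp)
  have hlt : ∀ x, ψ (b * r x / q x) * r x < ψ (a * r x / q x) * r x := by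
    intro x
    have := hr x
    have := hq x
    refine mul_lt_mul_of_pos_right (hψ.strictAntiOn ?_ ?_ ?_) (hr x)
    · exact mem_Ioi.2 (by positivity)
    · exact mem_Ioi.2 (by positivity)
    · gcongr
  have hpos : 0 < ∫ x, (ψ (a * r x / q x) * r x - ψ (b * r x / q x) * r x) ∂ν := by
    rw [integral_pos_iff_support_of_nonneg (fun x => (sub_pos.2 (hlt x)).le)
      ((hint a ha).sub (hint b hb))]
    have : Function.support (fun x => ψ (a * r x / q x) * r x - ψ (b * r x / q x) * r x)
        = univ := eq_univ_of_forall fun x => (sub_pos.2 (hlt x)).ne'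
    rw [this]
    simpa using hν
  rw [integral_sub (hint a ha) (hint b hb)] at hpos
  simpa using hpos

lemma IsInverseMarginal.exists_integral_le_one (hψ : IsInverseMarginal ψ C)
    (hq : ∀ x, 0 < q x) (hqi : Integrable q ν) {r : X → ℝ} (hr : ∀ x, 0 < r x) :
    ∃ l, 0 < l ∧ ∫ x, ψ (l * r x / q x) * r x ∂ν ≤ 1 := by
  have hC := hψ.const_nonneg
  have hI : 0 ≤ ∫ x, q x ∂ν := integral_nonneg fun x => (hq x).le
  have hl : 0 < C * (∫ x, q x ∂ν) + 1 := by positivity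
  refine ⟨_, hl, ?_⟩
  set l := C * (∫ x, q x ∂ν) + 1
  calc ∫ x, ψ (l * r x / q x) * r x ∂ν ≤ ∫ x, C * 1 / l * q x ∂ν := by
        refine integral_mono_of_nonneg (ae_of_all _ fun x => ?_) (hqi.const_mul _)
          (ae_of_all _ fun x => ?_)
        · exact mul_nonneg (hψ.pos _ (div_pos (mul_pos hl (hr x)) (hq x))).le (hr x).le
        · exact (le_abs_self _).trans (hψ.mul_le hq hr hl (hr x).le (by simp))
    _ = C * (∫ x, q x ∂ν) / l := by rw [integral_const_mul]; ring
    _ ≤ 1 := by rw [div_le_one hl]; simp [l]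

lemma IsInverseMarginal.exists_one_le_integral (hψ : IsInverseMarginal ψ C)
    (hq : ∀ x, 0 < q x) (hqm : Measurable q) (hqi : Integrable q ν) {r : X → ℝ}
    (hr : ∀ x, 0 < r x) (hrm : Measurable r) (hri : Integrable r ν) (hr1 : ∫ x, r x ∂ν = 1) :
    ∃ l, 0 < l ∧ 1 ≤ ∫ x, ψ (l * r x / q x) * r x ∂ν := by
  have hlpos : ∀ n : ℕ, (0 : ℝ) < 1 / ((n : ℝ) + 1) := fun n => by positivity
  have hy : ∀ (n : ℕ) x, 0 < 1 / ((n : ℝ) + 1) * r x / q x := fun n x =>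
    div_pos (mul_pos (hlpos n) (hr x)) (hq x)
  have hlim : Tendsto (fun n : ℕ => ∫ x, min 2 (ψ (1 / ((n : ℝ) + 1) * r x / q x)) * r x ∂ν) atTop
      (𝓝 (∫ x, 2 * r x ∂ν)) := by
    refine tendsto_integral_of_dominated_convergence (fun x => 2 * r x) (fun n => ?_)
      (hri.const_mul 2) (fun n => ae_of_all _ fun x => ?_) (ae_of_all _ fun x => ?_)
    · exact ((measurable_const.min (hψ.measurable.comp ((hrm.const_mul _).div hqm))).mul
        hrm).aestronglyMeasurable
    · have := hψ.pos _ (hy n x)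
      rw [Real.norm_of_nonneg (mul_nonneg (le_min zero_le_two this.le) (hr x).le)]
      exact mul_le_mul_of_nonneg_right (min_le_left _ _) (hr x).le
    · refine tendsto_const_nhds.congr' ?_
      obtain ⟨y, hy0, hy2⟩ := hψ.surj 2 two_pos
      have ht : Tendsto (fun n : ℕ => 1 / ((n : ℝ) + 1) * r x / q x) atTop (𝓝 0) := by
        simpa using (tendsto_one_div_add_atTop_nhds_zero_nat.mul_const (r x)).div_const (q x)
      filter_upwards [ht.eventually (gt_mem_nhds hy0)] with n hn
      rw [min_eq_left]
      exact hy2 ▸ (hψ.strictAntiOn (hy n x) hy0 hn).le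
  rw [integral_const_mul, hr1] at hlim
  obtain ⟨n, hn⟩ := (hlim.eventually (lt_mem_nhds (by norm_num : (1 : ℝ) < 2 * 1))).exists
  refine ⟨_, hlpos n, hn.le.trans (integral_mono_of_nonneg (ae_of_all _ fun x => ?_)
    (hψ.integrable (A := 1) hq hqm hqi hr hrm hrm (hlpos n) (fun x => (hr x).le) (by simp))
    (ae_of_all _ fun x => ?_))⟩
  · exact mul_nonneg (le_min zero_le_two (hψ.pos _ (hy n x)).le) (hr x).le
  · exact mul_le_mul_of_nonneg_right (min_le_right _ _) (hr x).le

/-- A function `e` that is larger where `f ≥ g` than where `f < g` has a strictly larger mean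
under `f` than under `g`. -/
lemma one_lt_lintegral_of_separates (hf : ∀ x, 0 < f x) (hfm : Measurable f)
    (hfi : Integrable f ν) (hgi : Integrable g ν) (hfg : ∫ x, f x ∂ν = ∫ x, g x ∂ν)
    (hne : ¬ f =ᵐ[ν] g) {e : X → ℝ} (he : Measurable e) (he0 : ∀ x, 0 ≤ e x)
    (hsep : ∀ x y, g x ≤ f x → f y < g y → e y < e x)
    (hegi : Integrable (fun x => e x * g x) ν) (heg : ∫ x, e x * g x ∂ν = 1) :
    1 < ∫⁻ x, ENNReal.ofReal (e x * f x) ∂ν := by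
  by_contra! hcon
  have hef0 : ∀ x, 0 ≤ e x * f x := fun x => mul_nonneg (he0 x) (hf x).le
  have hefi : Integrable (fun x => e x * f x) ν := by
    refine ⟨(he.mul hfm).aestronglyMeasurable, ?_⟩
    rw [hasFiniteIntegral_iff_ofReal (ae_of_all _ hef0)]
    exact hcon.trans_lt ENNReal.one_lt_top
  have hef : ∫ x, e x * f x ∂ν ≤ 1 := by
    rw [integral_eq_lintegral_of_nonneg_ae (ae_of_all _ hef0) hefi.aestronglyMeasurable]
    exact ENNReal.toReal_le_of_le_ofReal zero_le_one (by simpa using hcon)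
  have hexists : ∀ u v : X → ℝ, Integrable u ν → Integrable v ν →
      ∫ x, u x ∂ν = ∫ x, v x ∂ν → ¬ u =ᵐ[ν] v → ∃ᵐ x ∂ν, u x < v x := by
    intro u v hu hv huv hne hnot
    have hle : ∀ᵐ x ∂ν, 0 ≤ u x - v x := by
      filter_upwards [hnot] with x hx using sub_nonneg.2 (not_lt.1 hx)
    have h0 : ∫ x, (u x - v x) ∂ν = 0 := by rw [integral_sub hu hv, huv, sub_self]
    rw [integral_eq_zero_iff_of_nonneg_ae hle (hu.sub hv)] at h0
    exact hne (by filter_upwards [h0] with x hx using sub_eq_zero.1 hx)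
  have hlt := hexists f g hfi hgi hfg hne
  have hgt := hexists g f hgi hfi hfg.symm fun h => hne h.symm
  obtain ⟨x₀, hx₀⟩ := hgt.exists
  obtain ⟨y₀, hy₀⟩ := hlt.exists
  set m := sSup (e '' {y | f y < g y})
  have hle : ∀ y, f y < g y → e y ≤ m := fun y hy => le_csSup
    ⟨e x₀, by rintro _ ⟨z, hz, rfl⟩; exact (hsep x₀ z hx₀.le hz).le⟩ ⟨y, hy, rfl⟩
  have hge : ∀ x, g x ≤ f x → m ≤ e x := fun x hx => csSup_le ⟨e y₀, y₀, hy₀, rfl⟩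
    (by rintro _ ⟨z, hz, rfl⟩; exact (hsep x z hx hz).le)
  have hnn : ∀ x, 0 ≤ (e x - m) * (f x - g x) := by
    intro x
    rcases le_or_gt (g x) (f x) with h | h
    · exact mul_nonneg (sub_nonneg.2 (hge x h)) (sub_nonneg.2 h)
    · exact mul_nonneg_of_nonpos_of_nonpos (sub_nonpos.2 (hle x h)) (sub_nonpos.2 h.le)
  have hexp : (fun x => (e x - m) * (f x - g x))
      = fun x => (e x * f x - e x * g x) - m * (f x - g x) := by funext x; ring
  have hdi : Integrable (fun x => m * (f x - g x)) ν := (hfi.sub hgi).const_mul m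
  have hefg : Integrable (fun x => e x * f x - e x * g x) ν := hefi.sub hegi
  have hi : Integrable (fun x => (e x - m) * (f x - g x)) ν := by
    rw [hexp]; exact hefg.sub hdi
  have hint : ∫ x, (e x - m) * (f x - g x) ∂ν ≤ 0 := by
    rw [hexp, integral_sub hefg hdi, integral_sub hefi hegi, integral_const_mul,
      integral_sub hfi hgi, hfg, heg]
    linarith
  have h0 := (integral_eq_zero_iff_of_nonneg hnn hi).1
    (le_antisymm hint (integral_nonneg hnn))
  obtain ⟨x, hx, hx0⟩ := (hgt.and_eventually h0).exists
  obtain ⟨y, hy, hy0⟩ := (hlt.and_eventually h0).exists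
  have hxm : e x = m := by
    rcases mul_eq_zero.1 hx0 with h | h <;> linarith
  have hym : e y = m := by
    rcases mul_eq_zero.1 hy0 with h | h <;> linarith
  have := hsep x y hx.le hy
  linarith

/-- Near the endpoint `c = 0` the mean under `f` exceeds one. -/
lemma IsInverseMarginal.exists_one_lt_integral (hψ : IsInverseMarginal ψ C)
    (hq : ∀ x, 0 < q x) (hqm : Measurable q) (hqi : Integrable q ν)
    (hf : ∀ x, 0 < f x) (hg : ∀ x, 0 < g x) (hfm : Measurable f) (hgm : Measurable g)
    (hfi : Integrable f ν) (hgi : Integrable g ν) (hfg : ∫ x, f x ∂ν = ∫ x, g x ∂ν)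
    (hne : ¬ f =ᵐ[ν] g) (hsep : ∀ x y, g x ≤ f x → f y < g y → g x / q x < g y / q y)
    {L : ℝ → ℝ} (hL : ContinuousOn L (Icc 0 1)) (hLpos : ∀ c ∈ Icc (0 : ℝ) 1, 0 < L c)
    (hL0 : ∫ x, ψ (L 0 * g x / q x) * g x ∂ν = 1) :
    ∃ c ∈ Ioo (0 : ℝ) 1, 1 < ∫ x, ψ (L c * mixDensity f g c x / q x) * f x ∂ν := by
  by_contra! hcon
  have h0 : (0 : ℝ) ∈ Icc (0 : ℝ) 1 := by simp
  have hl0 := hLpos 0 h0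
  have harg : ∀ c ∈ Icc (0 : ℝ) 1, ∀ x, 0 < L c * mixDensity f g c x / q x := fun c hc x =>
    div_pos (mul_pos (hLpos c hc) (mixDensity_pos hf hg hc x)) (hq x)
  have harg0 : ∀ x, 0 < L 0 * g x / q x := fun x => div_pos (mul_pos hl0 (hg x)) (hq x)
  have hone : 1 < ∫⁻ x, ENNReal.ofReal (ψ (L 0 * g x / q x) * f x) ∂ν := by
    refine one_lt_lintegral_of_separates hf hfm hfi hgi hfg hne
      (hψ.measurable.comp ((hgm.const_mul _).div hqm)) (fun x => (hψ.pos _ (harg0 x)).le) ?_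
      (hψ.integrable (A := 1) hq hqm hqi hg hgm hgm hl0 (fun x => (hg x).le) (by simp)) hL0
    intro x y hx hy
    refine hψ.strictAntiOn (harg0 x) (harg0 y) ?_
    rw [mul_div_assoc, mul_div_assoc]
    exact mul_lt_mul_of_pos_left (hsep x y hx hy) hl0
  let s : ℕ → ℝ := fun n => 1 / ((n : ℝ) + 2)
  have hs : ∀ n, s n ∈ Ioo (0 : ℝ) 1 := fun n =>
    ⟨by positivity, by rw [div_lt_one (by positivity)]; linarith [(n.cast_nonneg : (0 : ℝ) ≤ n)]⟩
  have hslim : Tendsto s atTop (𝓝[Icc 0 1] 0) := by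
    refine tendsto_nhdsWithin_iff.2 ⟨?_, Eventually.of_forall fun n => Ioo_subset_Icc_self (hs n)⟩
    have := (tendsto_add_atTop_iff_nat 1).2 (tendsto_one_div_add_atTop_nhds_zero_nat (𝕜 := ℝ))
    refine this.congr fun n => ?_
    simp only [s]; push_cast; ring_nf
  have hfatou := lintegral_liminf_le (μ := ν) (u := atTop)
    (f := fun n x => ENNReal.ofReal (ψ (L (s n) * mixDensity f g (s n) x / q x) * f x))
    fun n => (hψ.measurable_comp hqm (measurable_mixDensity hfm hgm _) hfm _).ennreal_ofReal
  have hpt : ∀ x, liminf (fun n : ℕ => ENNReal.ofReal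
      (ψ (L (s n) * mixDensity f g (s n) x / q x) * f x)) atTop
      = ENNReal.ofReal (ψ (L 0 * g x / q x) * f x) := by
    intro x
    refine Tendsto.liminf_eq (ENNReal.tendsto_ofReal (Tendsto.mul_const _ ?_))
    have hc : ContinuousWithinAt (fun c => L c * mixDensity f g c x / q x) (Icc 0 1) 0 := by
      have h1 := hL 0 h0
      unfold mixDensity
      fun_prop
    have := (hψ.continuousOn.continuousAt (Ioi_mem_nhds (harg 0 h0 x))).tendsto.comp
      (hc.tendsto.comp hslim)
    simpa [mixDensity, Function.comp_def] using this
  simp_rw [hpt] at hfatou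
  refine (hone.trans_le hfatou).not_ge (liminf_le_of_frequently_le' ?_)
  refine Frequently.of_forall fun n => ?_
  have hn := Ioo_subset_Icc_self (hs n)
  rw [← ofReal_integral_eq_lintegral_ofReal]
  · simpa using hcon _ (hs n)
  · refine hψ.integrable (A := 1 / s n) hq hqm hqi (mixDensity_pos hf hg hn)
      (measurable_mixDensity hfm hgm _) hfm (hLpos _ hn) (fun x => (hf x).le) fun x => ?_
    have := (hs n).1
    rw [one_div, inv_mul_eq_div, le_div_iff₀ this]
    have := mul_nonneg (sub_nonneg.2 (hs n).2.le) (hg x).le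
    unfold mixDensity
    linarith
  · exact ae_of_all _ fun x => mul_nonneg (hψ.pos _ (harg _ hn x)).le (hf x).le

/-- Calibration of the two means for abstract densities `f`, `g` and `q`. -/
theorem IsInverseMarginal.exists_calibration (hψ : IsInverseMarginal ψ C)
    (hq : ∀ x, 0 < q x) (hqm : Measurable q) (hqi : Integrable q ν)
    (hf : ∀ x, 0 < f x) (hg : ∀ x, 0 < g x) (hfm : Measurable f) (hgm : Measurable g)
    (hfi : Integrable f ν) (hgi : Integrable g ν) (hf1 : ∫ x, f x ∂ν = 1)
    (hg1 : ∫ x, g x ∂ν = 1)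
    (hsep : ∀ x y, g x ≤ f x → f y < g y → g x / q x < g y / q y)
    (hsep' : ∀ x y, f x ≤ g x → g y < f y → f x / q x < f y / q y) :
    ∃ c l : ℝ, c ∈ Ioo (0 : ℝ) 1 ∧ 0 < l ∧
      ∫ x, ψ (l * mixDensity f g c x / q x) * f x ∂ν = 1 ∧
      ∫ x, ψ (l * mixDensity f g c x / q x) * g x ∂ν = 1 := by
  have hν : ν ≠ 0 := by rintro rfl; simp at hf1
  have hmi : ∀ c, Integrable (mixDensity f g c) ν := fun c =>
    (hfi.const_mul c).add (hgi.const_mul (1 - c))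
  have hm1 : ∀ c, ∫ x, mixDensity f g c x ∂ν = 1 := fun c => by
    unfold mixDensity
    rw [integral_add (hfi.const_mul c) (hgi.const_mul (1 - c)), integral_const_mul,
      integral_const_mul, hf1, hg1]
    ring
  have hmm := measurable_mixDensity hfm hgm
  have hmcont : ∀ x, Continuous fun c => mixDensity f g c x := fun x => by
    unfold mixDensity; fun_prop
  obtain ⟨L, hLc, hL⟩ := exists_continuousOn_level (K := Icc 0 1)
    (h := fun c l => ∫ x, ψ (l * mixDensity f g c x / q x) * mixDensity f g c x ∂ν)
    (hψ.continuousOn_integral hq hqm hqi hf hg hfm hgm subset_rfl hmm hmcont zero_le_one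
      (fun c hc x => (mixDensity_pos hf hg hc x).le) (by simp))
    (fun c hc => hψ.strictAntiOn_integral hν hq hqm hqi (mixDensity_pos hf hg hc) (hmm c))
    (fun c hc => hψ.exists_integral_le_one hq hqi (mixDensity_pos hf hg hc))
    (fun c hc => hψ.exists_one_le_integral hq hqm hqi (mixDensity_pos hf hg hc) (hmm c)
      (hmi c) (hm1 c))
  have hLpos : ∀ c ∈ Icc (0 : ℝ) 1, 0 < L c := fun c hc => (hL c hc).1
  have hFi : ∀ c ∈ Ioo (0 : ℝ) 1,
      Integrable (fun x => ψ (L c * mixDensity f g c x / q x) * f x) ν := fun c hc =>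
    hψ.integrable (A := 1 / c) hq hqm hqi (mixDensity_pos hf hg (Ioo_subset_Icc_self hc)) (hmm c)
      hfm (hLpos c (Ioo_subset_Icc_self hc)) (fun x => (hf x).le) fun x => by
        rw [one_div, inv_mul_eq_div, le_div_iff₀ hc.1]
        have := mul_nonneg (sub_nonneg.2 hc.2.le) (hg x).le
        unfold mixDensity
        linarith
  have hGi : ∀ c ∈ Ioo (0 : ℝ) 1,
      Integrable (fun x => ψ (L c * mixDensity f g c x / q x) * g x) ν := fun c hc =>
    hψ.integrable (A := 1 / (1 - c)) hq hqm hqi (mixDensity_pos hf hg (Ioo_subset_Icc_self hc))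
      (hmm c) hgm (hLpos c (Ioo_subset_Icc_self hc)) (fun x => (hg x).le) fun x => by
        rw [one_div, inv_mul_eq_div, le_div_iff₀ (sub_pos.2 hc.2)]
        have := mul_nonneg hc.1.le (hf x).le
        unfold mixDensity
        linarith
  have hsum : ∀ c ∈ Ioo (0 : ℝ) 1, c * (∫ x, ψ (L c * mixDensity f g c x / q x) * f x ∂ν)
      + (1 - c) * (∫ x, ψ (L c * mixDensity f g c x / q x) * g x ∂ν) = 1 := by
    intro c hc
    rw [← integral_const_mul, ← integral_const_mul,
      ← integral_add ((hFi c hc).const_mul _) ((hGi c hc).const_mul _)]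
    refine (integral_congr_ae (ae_of_all _ fun x => ?_)).trans
      (hL c (Ioo_subset_Icc_self hc)).2
    simp only [mixDensity]
    ring
  suffices h : ∃ c ∈ Ioo (0 : ℝ) 1, ∫ x, ψ (L c * mixDensity f g c x / q x) * f x ∂ν = 1 by
    obtain ⟨c, hc, h1⟩ := h
    refine ⟨c, L c, hc, hLpos c (Ioo_subset_Icc_self hc), h1, ?_⟩
    have h2 := hsum c hc
    rw [h1] at h2
    refine mul_left_cancel₀ (sub_pos.2 hc.2).ne' ?_
    linarith
  by_cases hae : f =ᵐ[ν] g
  · have hc : (1 / 2 : ℝ) ∈ Ioo (0 : ℝ) 1 := by norm_num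
    refine ⟨1 / 2, hc, ?_⟩
    have hcongr : ∫ x, ψ (L (1 / 2) * mixDensity f g (1 / 2) x / q x) * f x ∂ν
        = ∫ x, ψ (L (1 / 2) * mixDensity f g (1 / 2) x / q x) * g x ∂ν :=
      integral_congr_ae (by filter_upwards [hae] with x hx; rw [hx])
    have h2 := hsum _ hc
    rw [← hcongr] at h2
    linarith
  obtain ⟨a, ha, ha1⟩ := hψ.exists_one_lt_integral hq hqm hqi hf hg hfm hgm hfi hgi
    (hf1.trans hg1.symm) hae hsep hLc hLpos (by simpa [mixDensity] using (hL 0 (by simp)).2)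
  obtain ⟨b, hb, hb1⟩ : ∃ b ∈ Ioo (0 : ℝ) 1,
      1 < ∫ x, ψ (L b * mixDensity f g b x / q x) * g x ∂ν := by
    have hmaps : MapsTo (fun c : ℝ => 1 - c) (Icc 0 1) (Icc 0 1) := fun c hc =>
      ⟨by linarith [hc.2], by linarith [hc.1]⟩
    obtain ⟨b, hb, hb1⟩ := hψ.exists_one_lt_integral hq hqm hqi hg hf hgm hfm hgi hfi
      (hg1.trans hf1.symm) (fun h => hae h.symm) hsep' (L := fun c => L (1 - c))
      (hLc.comp (by fun_prop) hmaps) (fun c hc => hLpos _ (hmaps hc))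
      (by simpa [mixDensity] using (hL 1 (by simp)).2)
    refine ⟨1 - b, ⟨by linarith [hb.2], by linarith [hb.1]⟩, ?_⟩
    have : ∀ x, mixDensity f g (1 - b) x = mixDensity g f b x := fun x => by
      unfold mixDensity; ring
    simpa only [this] using hb1
  have hb2 : ∫ x, ψ (L b * mixDensity f g b x / q x) * f x ∂ν ≤ 1 := by
    have h2 := hsum b hb
    have h3 := mul_lt_mul_of_pos_left hb1 (sub_pos.2 hb.2)
    by_contra! h4
    have h5 := mul_lt_mul_of_pos_left h4 hb.1
    linarith
  have hsub : uIcc a b ⊆ Ioo 0 1 := ordConnected_Ioo.uIcc_subset ha hb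
  have hmin : 0 < min a b := lt_min ha.1 hb.1
  have hcont : ContinuousOn (fun c => ∫ x, ψ (L c * mixDensity f g c x / q x) * f x ∂ν)
      (uIcc a b) := by
    refine (hψ.continuousOn_integral hq hqm hqi hf hg hfm hgm (K := uIcc a b)
      (hsub.trans Ioo_subset_Icc_self) (u := fun _ => f) (fun _ => hfm)
      (fun _ => continuous_const) (A := 1 / min a b) (by positivity)
      (fun _ _ x => (hf x).le) ?_).comp (f := fun c => (c, L c))
      (continuousOn_id.prodMk (hLc.mono (hsub.trans Ioo_subset_Icc_self)))
      fun c hc => ⟨hc, hLpos c (Ioo_subset_Icc_self (hsub hc))⟩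
    intro c hc x
    rw [one_div, inv_mul_eq_div, le_div_iff₀ hmin]
    have h1 := mul_nonneg (sub_nonneg.2 (hsub hc).2.le) (hg x).le
    have h2 := mul_le_mul_of_nonneg_right hc.1 (hf x).le
    unfold mixDensity
    linarith
  obtain ⟨c, hc, hc1⟩ := isPreconnected_uIcc.intermediate_value right_mem_uIcc left_mem_uIcc
    hcont ⟨hb2, ha1.le⟩
  exact ⟨c, hsub hc, hc1⟩

end Calibration

/-- The inverse of the derivative of a strictly concave utility, cut off outside the positive
half-line. -/
lemma exists_isInverseMarginal {U U' ψ : ℝ → ℝ} (hU_conc : StrictConcaveOn ℝ (Ioi 0) U)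
    (hU_deriv : ∀ x ∈ Ioi (0 : ℝ), HasDerivAt U (U' x) x)
    (hU'_lim : Tendsto U' atTop (𝓝 0)) (hU'_bdd : ∃ C, ∀ x ∈ Ioi (0 : ℝ), |x * U' x| ≤ C)
    (hψ : ∀ y ∈ Ioi (0 : ℝ), ψ y ∈ Ioi (0 : ℝ) ∧ U' (ψ y) = y)
    (hψ' : ∀ x ∈ Ioi (0 : ℝ), ψ (U' x) = x) :
    ∃ C, IsInverseMarginal ((Ioi 0).indicator ψ) C := by
  have hanti : StrictAntiOn U' (Ioi 0) := fun x hx y hy hxy =>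
    (hU_conc.lt_slope_of_hasDerivAt hx hy hxy (hU_deriv y hy)).trans
      (hU_conc.slope_lt_of_hasDerivAt hx hy hxy (hU_deriv x hx))
  have hU'_pos : ∀ x ∈ Ioi (0 : ℝ), 0 < U' x := by
    intro x hx
    have hx1 : x + 1 ∈ Ioi (0 : ℝ) := mem_Ioi.2 (by linarith [mem_Ioi.1 hx])
    refine lt_of_le_of_lt ?_ (hanti hx hx1 (lt_add_one x))
    refine le_of_tendsto hU'_lim ?_
    filter_upwards [eventually_ge_atTop (x + 1)] with y hy
    exact hanti.antitoneOn hx1 (lt_of_lt_of_le hx1 hy) hy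
  have hψanti : StrictAntiOn ψ (Ioi 0) := by
    intro a ha b hb hab
    by_contra! hcon
    have := hanti.antitoneOn (hψ a ha).1 (hψ b hb).1 hcon
    rw [(hψ a ha).2, (hψ b hb).2] at this
    exact this.not_gt hab
  have hψcont : ContinuousOn ψ (Ioi 0) := by
    have himage : (fun y => -ψ y) '' Ioi 0 = Iio 0 := by
      ext t
      constructor
      · rintro ⟨y, hy, rfl⟩
        exact neg_lt_zero.2 (mem_Ioi.1 (hψ y hy).1)
      · intro ht
        have ht' : -t ∈ Ioi (0 : ℝ) := mem_Ioi.2 (neg_pos.2 ht)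
        exact ⟨U' (-t), hU'_pos _ ht', by simp [hψ' _ ht']⟩
    intro y hy
    have hc := StrictMonoOn.continuousAt_of_image_mem_nhds (f := fun y => -ψ y) (a := y)
      (fun a ha b hb hab => neg_lt_neg (hψanti ha hb hab)) (Ioi_mem_nhds hy)
      (himage ▸ Iio_mem_nhds (neg_lt_zero.2 (mem_Ioi.1 (hψ y hy).1)))
    simpa [Pi.neg_def] using hc.neg.continuousWithinAt (s := Ioi 0)
  obtain ⟨C, hC⟩ := hU'_bdd
  have heq : EqOn ((Ioi 0).indicator ψ) ψ (Ioi 0) := eqOn_indicator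
  refine ⟨C, ?_, fun y hy => ?_, hψanti.congr heq.symm, hψcont.congr heq, fun y hy => ?_,
    fun t ht => ⟨U' t, hU'_pos t ht, (heq (hU'_pos t ht)).trans (hψ' t ht)⟩⟩
  · classical
    rw [← piecewise_eq_indicator]
    exact hψcont.measurable_piecewise continuousOn_const measurableSet_Ioi
  · rw [heq hy]
    exact (hψ y hy).1
  · rw [heq hy, le_div_iff₀ hy]
    have := hC _ (hψ y hy).1
    rw [(hψ y hy).2] at this
    exact (le_abs_self _).trans this

/-- A monotone function on a linear order that carries a measurable strictly monotone real-valued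
function is measurable. -/
lemma Monotone.measurable_of_strictMono {X : Type*} [LinearOrder X] [MeasurableSpace X]
    {t s : X → ℝ} (hs : Monotone s) (ht : StrictMono t) (htm : Measurable t) : Measurable s := by
  refine measurable_of_Ioi fun a => ?_
  have : s ⁻¹' Ioi a = t ⁻¹' (upperClosure (t '' (s ⁻¹' Ioi a)) : Set ℝ) := by
    ext x
    simp only [mem_preimage, SetLike.mem_coe, mem_upperClosure, mem_image, exists_exists_and_eq_and]
    constructor
    · exact fun hx => ⟨x, hx, le_rfl⟩
    · rintro ⟨z, hz, hzx⟩
      exact lt_of_lt_of_le hz (hs (ht.le_iff_le.1 hzx))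
  rw [this]
  exact htm (upperClosure _).upper.ordConnected.measurableSet

lemma mul_integral_lt_mul_integral {α : Type*} [MeasurableSpace α] {w : Measure α} (hw : w ≠ 0)
    {u v : α → ℝ} (hu : Integrable u w) (hv : Integrable v w) {r s : ℝ}
    (h : ∀ᵐ z ∂w, r * u z < s * v z) : r * ∫ z, u z ∂w < s * ∫ z, v z ∂w := by
  rw [← integral_const_mul, ← integral_const_mul]
  refine lt_of_le_of_ne
    (integral_mono_ae (hu.const_mul r) (hv.const_mul s) (h.mono fun _ hz => hz.le)) fun heq => ?_
  have hae := (integral_eq_iff_of_ae_le (hu.const_mul r) (hv.const_mul s)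
    (h.mono fun _ hz => hz.le)).1 heq
  refine hw (ae_eq_bot.1 (eventually_false_iff_eq_bot.1 ?_))
  filter_upwards [h, hae] with z h1 h2 using h1.ne h2

section Mixture

variable {M X : Type*} [LinearOrder M] [MeasurableSpace M] [LinearOrder X] {p : M → X → ℝ}
  {a b : M} {w : Measure M} [IsProbabilityMeasure w]

/-- The ratio of a mixture to a density with a smaller parameter is strictly increasing. -/
lemma IsSTP3.mixture_lt_of_left (hp : IsSTP3 p) (hw : ∀ᵐ μ ∂w, a < μ)
    (hi : ∀ x, Integrable (fun μ => p μ x) w) {x y : X} (hxy : x < y) :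
    p a y * ∫ μ, p μ x ∂w < p a x * ∫ μ, p μ y ∂w :=
  mul_integral_lt_mul_integral (NeZero.ne w) (hi x) (hi y) (hw.mono fun _ hμ =>
    sub_pos.1 (hp.2.1 _ _ _ _ hμ hxy |>.trans_eq (by ring)))

/-- The ratio of a mixture to a density with a larger parameter is strictly decreasing. -/
lemma IsSTP3.mixture_lt_of_right (hp : IsSTP3 p) (hw : ∀ᵐ μ ∂w, μ < b)
    (hi : ∀ x, Integrable (fun μ => p μ x) w) {x y : X} (hxy : x < y) :
    p b x * ∫ μ, p μ y ∂w < p b y * ∫ μ, p μ x ∂w :=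
  mul_integral_lt_mul_integral (NeZero.ne w) (hi y) (hi x) (hw.mono fun _ hμ =>
    sub_pos.1 (hp.2.1 _ _ _ _ hμ hxy |>.trans_eq (by ring)))

/-- For parameters between `a` and `b` the densities at a fixed point are bounded by a constant, hence
integrable in the parameter. -/
lemma IsSTP3.integrable_mixture [MeasurableSpace X] (hp : IsSTP3 p) {ν : Measure X}
    (hpi : ∀ μ, Integrable (p μ) ν) (hp1 : ∀ μ, ∫ x, p μ x ∂ν = 1)
    (hpm : ∀ x, Measurable fun μ => p μ x) (hw : ∀ᵐ μ ∂w, a < μ ∧ μ < b) (x : X) :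
    Integrable (fun μ => p μ x) w := by
  have hpos := hp.1
  let k : X → ℝ := fun y => min (p a y / p a x) (p b y / p b x)
  have hk : ∀ y, 0 < k y := fun y =>
    lt_min (div_pos (hpos _ _) (hpos _ _)) (div_pos (hpos _ _) (hpos _ _))
  have hki : Integrable k ν := ((hpi a).div_const _).inf ((hpi b).div_const _)
  have hν : ν ≠ 0 := by rintro rfl; simpa using hp1 a
  have hI : 0 < ∫ y, k y ∂ν := by
    rw [integral_pos_iff_support_of_nonneg (fun y => (hk y).le) hki,
      eq_univ_of_forall (s := Function.support k) fun y => (hk y).ne']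
    simpa using hν
  refine Integrable.of_bound (hpm x).aestronglyMeasurable (1 / ∫ y, k y ∂ν) ?_
  filter_upwards [hw] with μ hμ
  rw [Real.norm_of_nonneg (hpos _ _).le, le_div_iff₀ hI, ← integral_const_mul, ← hp1 μ]
  refine integral_mono (hki.const_mul _) (hpi μ) fun y => ?_
  have ha := hpos a x
  have hb := hpos b x
  have hμx := hpos μ x
  rcases lt_trichotomy x y with h | rfl | h
  · have := hp.2.1 _ _ _ _ hμ.1 h
    calc p μ x * k y ≤ p μ x * (p a y / p a x) := by gcongr; exact min_le_left _ _
      _ ≤ p μ y := by rw [← mul_div_assoc, div_le_iff₀ ha]; linarith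
  · calc p μ x * k x ≤ p μ x * (p a x / p a x) := by gcongr; exact min_le_left _ _
      _ ≤ p μ x := by rw [div_self ha.ne', mul_one]
  · have := hp.2.1 _ _ _ _ hμ.2 h
    calc p μ x * k y ≤ p μ x * (p b y / p b x) := by gcongr; exact min_le_right _ _
      _ ≤ p μ y := by rw [← mul_div_assoc, div_le_iff₀ hb]; linarith

end Mixture

/-- Proposition: boundary calibration.
In the STP₃ setting with margins `Δ⁻ < Δ⁺`, mixture alternative density `q`, utility `U`
(increasing, strictly concave, continuously differentiable, `U'(x) → 0`, `x·U'(x)`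
bounded) and `ψ = (U')⁻¹`, with
`ε_{c,λ}(x) = ψ(λ·(c·p_{Δ⁻}(x) + (1-c)·p_{Δ⁺}(x))/q(x))`, there exists
`(c*, λ*) ∈ (0,1) × (0,∞)` with `E_{P_{Δ⁻}}[ε_{c*,λ*}] = 1` and `E_{P_{Δ⁺}}[ε_{c*,λ*}] = 1`. -/
theorem stmt9 {M X : Type*} [LinearOrder M] [MeasurableSpace M]
    [LinearOrder X] [MeasurableSpace X]
    (ν : Measure X) [SigmaFinite ν]
    (p : M → X → ℝ)
    (hp_meas : ∀ μ, Measurable (p μ))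
    (hp_meas' : ∀ x, Measurable fun μ => p μ x)
    (hSTP3 : IsSTP3 p)
    (P : M → Measure X)
    (hP : ∀ μ, P μ = ν.withDensity fun x => ENNReal.ofReal (p μ x))
    (hP_prob : ∀ μ, IsProbabilityMeasure (P μ))
    (Δm Δp : M) (hΔ : Δm < Δp)
    (w : Measure M) [IsProbabilityMeasure w]
    (hw : w {μ | Δm < μ ∧ μ < Δp}ᶜ = 0)
    (q : X → ℝ) (hq : ∀ x, q x = ∫ μ, p μ x ∂w)
    (U U' ψ : ℝ → ℝ)
    (hU_mono : StrictMonoOn U (Ioi 0))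
    (hU_conc : StrictConcaveOn ℝ (Ioi 0) U)
    (hU_deriv : ∀ x ∈ Ioi (0 : ℝ), HasDerivAt U (U' x) x)
    (hU'_cont : ContinuousOn U' (Ioi 0))
    (hU'_lim : Filter.Tendsto U' Filter.atTop (nhds 0))
    (hU'_bdd : ∃ C, ∀ x ∈ Ioi (0 : ℝ), |x * U' x| ≤ C)
    (hψ : ∀ y ∈ Ioi (0 : ℝ), ψ y ∈ Ioi (0 : ℝ) ∧ U' (ψ y) = y)
    (hψ' : ∀ x ∈ Ioi (0 : ℝ), ψ (U' x) = x) :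
    ∃ c lam : ℝ, c ∈ Ioo (0 : ℝ) 1 ∧ 0 < lam ∧
      ∫ x, ψ (lam * (c * p Δm x + (1 - c) * p Δp x) / q x) ∂(P Δm) = 1 ∧
      ∫ x, ψ (lam * (c * p Δm x + (1 - c) * p Δp x) / q x) ∂(P Δp) = 1 := by
  have hp := hSTP3.1
  have hpl : ∀ μ, ∫⁻ x, ENNReal.ofReal (p μ x) ∂ν = 1 := fun μ => by
    rw [← setLIntegral_univ, ← withDensity_apply _ MeasurableSet.univ, ← hP]
    exact (hP_prob μ).measure_univ
  have hpi : ∀ μ, Integrable (p μ) ν := fun μ => by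
    refine ⟨(hp_meas μ).aestronglyMeasurable, ?_⟩
    rw [hasFiniteIntegral_iff_ofReal (ae_of_all _ fun x => (hp μ x).le), hpl]
    exact ENNReal.one_lt_top
  have hp1 : ∀ μ, ∫ x, p μ x ∂ν = 1 := fun μ => by
    rw [integral_eq_lintegral_of_nonneg_ae (ae_of_all _ fun x => (hp μ x).le)
      (hp_meas μ).aestronglyMeasurable, hpl, ENNReal.toReal_one]
  have hwae : ∀ᵐ μ ∂w, Δm < μ ∧ μ < Δp := hw
  have hwi : ∀ x, Integrable (fun μ => p μ x) w :=
    hSTP3.integrable_mixture hpi hp1 hp_meas' hwae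
  have hqpos : ∀ x, 0 < q x := fun x => by
    rw [hq, integral_pos_iff_support_of_nonneg (fun μ => (hp μ x).le) (hwi x),
      eq_univ_of_forall (s := Function.support fun μ => p μ x) fun μ => (hp μ x).ne']
    simp
  have hqm : ∀ {x y}, x < y → p Δm y * q x < p Δm x * q y := fun h => by
    rw [hq, hq]
    exact hSTP3.mixture_lt_of_left (hwae.mono fun _ h => h.1) hwi h
  have hqp : ∀ {x y}, x < y → p Δp x * q y < p Δp y * q x := fun h => by
    rw [hq, hq]
    exact hSTP3.mixture_lt_of_right (hwae.mono fun _ h => h.2) hwi h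
  have hratio : StrictMono fun x => p Δp x / p Δm x := fun x y h => by
    rw [div_lt_div_iff₀ (hp _ _) (hp _ _)]
    have := hSTP3.2.1 _ _ _ _ hΔ h
    linarith
  have hqratio : StrictMono fun x => q x / p Δm x := fun x y h => by
    rw [div_lt_div_iff₀ (hp _ _) (hp _ _)]
    linarith [hqm h]
  have hq_meas : Measurable q := by
    have := (hqratio.monotone.measurable_of_strictMono hratio
      ((hp_meas Δp).div (hp_meas Δm))).mul (hp_meas Δm)
    convert this using 1
    funext x
    exact (div_mul_cancel₀ _ (hp _ _).ne').symm
  have hq_int : Integrable q ν := by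
    obtain ⟨x₀⟩ : Nonempty X := by
      by_contra! hX
      simpa [integral_of_isEmpty] using hp1 Δm
    refine (((hpi Δm).const_mul (q x₀ / p Δm x₀)).add
      ((hpi Δp).const_mul (q x₀ / p Δp x₀))).mono' hq_meas.aestronglyMeasurable
      (ae_of_all _ fun x => ?_)
    rw [Real.norm_of_nonneg (hqpos x).le, Pi.add_apply]
    have hm0 : 0 ≤ q x₀ / p Δm x₀ * p Δm x :=
      mul_nonneg (div_pos (hqpos _) (hp _ _)).le (hp _ _).le
    have hp0 : 0 ≤ q x₀ / p Δp x₀ * p Δp x :=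
      mul_nonneg (div_pos (hqpos _) (hp _ _)).le (hp _ _).le
    rcases le_or_gt x x₀ with h | h
    · have h1 := hqratio.monotone h
      simp only [div_le_iff₀ (hp Δm x)] at h1
      linarith
    · have h1 : q x ≤ q x₀ / p Δp x₀ * p Δp x := by
        rw [div_mul_eq_mul_div, le_div_iff₀ (hp _ _)]
        linarith [hqp h]
      linarith
  obtain ⟨C, hψC⟩ := exists_isInverseMarginal hU_conc hU_deriv hU'_lim hU'_bdd hψ hψ'
  have hcross : ∀ {x y}, p Δp x / p Δm x < p Δp y / p Δm y → x < y := hratio.lt_iff_lt.1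
  obtain ⟨c, l, hc, hl, h1, h2⟩ := hψC.exists_calibration hqpos hq_meas hq_int (hp Δm) (hp Δp)
    (hp_meas Δm) (hp_meas Δp) (hpi Δm) (hpi Δp) (hp1 Δm) (hp1 Δp)
    (fun x y hx hy => by
      have hxy : x < y := hcross (((div_le_one (hp _ _)).2 hx).trans_lt
        ((one_lt_div (hp _ _)).2 hy))
      rw [div_lt_div_iff₀ (hqpos _) (hqpos _)]
      exact hqp hxy)
    (fun x y hx hy => by
      have hxy : y < x := hcross (((div_lt_one (hp _ _)).2 hy).trans_le
        ((one_le_div (hp _ _)).2 hx))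
      rw [div_lt_div_iff₀ (hqpos _) (hqpos _)]
      exact hqm hxy)
  have hchange : ∀ μ, ∫ x, ψ (l * (c * p Δm x + (1 - c) * p Δp x) / q x) ∂(P μ)
      = ∫ x, (Ioi 0).indicator ψ (l * mixDensity (p Δm) (p Δp) c x / q x) * p μ x ∂ν := by
    intro μ
    rw [hP, integral_withDensity_eq_integral_toReal_smul (hp_meas μ).ennreal_ofReal
      (ae_of_all _ fun x => ENNReal.ofReal_lt_top)]
    refine integral_congr_ae (ae_of_all _ fun x => ?_)
    have hy : l * mixDensity (p Δm) (p Δp) c x / q x ∈ Ioi (0 : ℝ) := div_pos (mul_pos hl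
      (mixDensity_pos (hp Δm) (hp Δp) (Ioo_subset_Icc_self hc) x)) (hqpos x)
    simp only [indicator_of_mem hy, ENNReal.toReal_ofReal (hp μ x).le, smul_eq_mul]
    exact mul_comm _ _
  exact ⟨c, l, hc, hl, (hchange Δm).trans h1, (hchange Δp).trans h2⟩
end

section
/- Let {p_μ : μ ∈ M} be an STP₃ family of strictly positive densities on a totally ordered sample space X with respect to a σ-finite measure ν, fix μ₁ < μ₂ in M, let w be a probability measure on M₁ := {μ ∈ M : μ₁ < μ < μ₂} (assumed non-empty), and define q(x) := ∫_{M₁} p_μ(x) dw(μ). Then the triple of functions (p_{μ₁}, q, p_{μ₂}) is STP₃: q is strictly positive; for all x₁ < x₂ the 2×2 determinants of each consecutive pair (p_{μ₁}, q) and (q, p_{μ₂}) at (x₁,x₂) are strictly positive; and for all x₁ < x₂ < x₃ the 3×3 determinant det[(p_{μ₁}(x_j)), (q(x_j)), (p_{μ₂}(x_j))] is strictly positive. -/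
open MeasureTheory Set
open scoped ENNReal NNReal

/-- An integrable function that is almost everywhere positive for a nonzero measure has positive
integral. -/
theorem integral_pos_of_ae_pos {α : Type*} [MeasurableSpace α] {w : Measure α} [NeZero w]
    {f : α → ℝ} (hf : Integrable f w) (hpos : ∀ᵐ a ∂w, 0 < f a) : 0 < ∫ a, f a ∂w := by
  have hnonneg : 0 ≤ᵐ[w] f := hpos.mono fun _ h => h.le
  refine lt_of_le_of_ne (integral_nonneg_of_ae hnonneg) fun h => ?_
  have hzero := (integral_eq_zero_iff_of_nonneg_ae hnonneg hf).1 h.symm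
  obtain ⟨a, ha, ha'⟩ := (hpos.and hzero).exists
  exact ha.ne' ha'

/-- Lemma: STP₃ is preserved by mixing over the interior.
If `{p_μ}` is STP₃, `μ₁ < μ₂`, `w` is a probability measure concentrated on
`M₁ = {μ : μ₁ < μ < μ₂}`, and `q(x) = ∫ p_μ(x) dw(μ)`, then the triple
`(p_{μ₁}, q, p_{μ₂})` is STP₃: `q` is strictly positive, the `2×2` determinants of the
consecutive pairs `(p_{μ₁}, q)` and `(q, p_{μ₂})` are strictly positive, and the `3×3`
determinant with rows `p_{μ₁}, q, p_{μ₂}` is strictly positive. -/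
theorem stmt11 {M X : Type*} [LinearOrder M] [MeasurableSpace M]
    [LinearOrder X] [MeasurableSpace X]
    (ν : Measure X) [SigmaFinite ν]
    (p : M → X → ℝ)
    (hSTP3 : IsSTP3 p)
    (hp_meas : ∀ x, Measurable fun μ => p μ x)
    (μa μb : M) (hμ : μa < μb)
    (w : Measure M) [IsProbabilityMeasure w]
    (hw : w {μ | μa < μ ∧ μ < μb}ᶜ = 0)
    (hp_int : ∀ x, Integrable (fun μ => p μ x) w)
    (q : X → ℝ) (hq : ∀ x, q x = ∫ μ, p μ x ∂w) :
    (∀ x, 0 < q x) ∧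
    (∀ x₁ x₂ : X, x₁ < x₂ → 0 < p μa x₁ * q x₂ - p μa x₂ * q x₁) ∧
    (∀ x₁ x₂ : X, x₁ < x₂ → 0 < q x₁ * p μb x₂ - q x₂ * p μb x₁) ∧
    (∀ x₁ x₂ x₃ : X, x₁ < x₂ → x₂ < x₃ →
      0 < Matrix.det !![p μa x₁, p μa x₂, p μa x₃;
                        q x₁, q x₂, q x₃;
                        p μb x₁, p μb x₂, p μb x₃]) := by
  obtain ⟨hpos, hdet₂, hdet₃⟩ := hSTP3
  have hmem : ∀ᵐ μ ∂w, μa < μ ∧ μ < μb := hw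
  have hcomb : ∀ (a b c : ℝ) (x₁ x₂ x₃ : X),
      (∀ μ, μa < μ → μ < μb → 0 < a * p μ x₁ + b * p μ x₂ + c * p μ x₃) →
      0 < a * q x₁ + b * q x₂ + c * q x₃ := by
    intro a b c x₁ x₂ x₃ h
    have h₁ := (hp_int x₁).const_mul a
    have h₂ := (hp_int x₂).const_mul b
    have h₃ := (hp_int x₃).const_mul c
    have key := integral_pos_of_ae_pos ((h₁.add h₂).add h₃)
      (hmem.mono fun μ hμ => h μ hμ.1 hμ.2)
    rwa [integral_add' (h₁.add h₂) h₃, integral_add' h₁ h₂, integral_const_mul,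
      integral_const_mul, integral_const_mul, ← hq, ← hq, ← hq] at key
  refine ⟨fun x => ?_, fun x₁ x₂ hx => ?_, fun x₁ x₂ hx => ?_, fun x₁ x₂ x₃ h₁₂ h₂₃ => ?_⟩
  · rw [hq]
    exact integral_pos_of_ae_pos (hp_int x) (.of_forall fun μ => hpos μ x)
  · have := hcomb (-p μa x₂) (p μa x₁) 0 x₁ x₂ x₂ fun μ ha _ => by
      linarith [hdet₂ μa μ x₁ x₂ ha hx]
    linarith
  · have := hcomb (p μb x₂) (-p μb x₁) 0 x₁ x₂ x₂ fun μ _ hb => by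
      linarith [hdet₂ μ μb x₁ x₂ hb hx]
    linarith
  · have := hcomb (p μa x₃ * p μb x₂ - p μa x₂ * p μb x₃)
      (p μa x₁ * p μb x₃ - p μa x₃ * p μb x₁)
      (p μa x₂ * p μb x₁ - p μa x₁ * p μb x₂) x₁ x₂ x₃ fun μ ha hb => by
        have h := hdet₃ μa μ μb x₁ x₂ x₃ ha hb h₁₂ h₂₃
        simp only [Matrix.det_fin_three, Matrix.of_apply, Matrix.cons_val] at h
        linarith
    simp only [Matrix.det_fin_three, Matrix.of_apply, Matrix.cons_val]
    linarith
end

section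
/- Consider the Gaussian location model on ℝ with known variance v > 0: for μ ∈ ℝ, the observation X̄ has density φ_v(x̄ − μ), where φ_v is the density of N(0, v). Fix margins Δ⁻ < Δ⁺, let w be a probability measure on (Δ⁻, Δ⁺) that is symmetric around the midpoint m := (Δ⁻ + Δ⁺)/2 (i.e. the pushforward of w under μ ↦ 2m − μ equals w), and set q(x̄) := ∫_{Δ⁻}^{Δ⁺} φ_v(x̄ − μ) dw(μ). Then the boundary-mixture likelihood ratio at c = 1/2, ε_{1/2}(x̄) := q(x̄) / ((1/2)·φ_v(x̄ − Δ⁻) + (1/2)·φ_v(x̄ − Δ⁺)), satisfies E_{Δ⁻}[ε_{1/2}(X̄)] = E_{Δ⁺}[ε_{1/2}(X̄)], i.e. the boundary calibration equalities hold with c* = 1/2. -/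
open MeasureTheory ProbabilityTheory
open scoped ENNReal NNReal

/-- The centered Gaussian density is even. -/
lemma gaussianPDFReal_zero_neg (v : ℝ≥0) (x : ℝ) :
    gaussianPDFReal 0 v (-x) = gaussianPDFReal 0 v x := by
  simp [gaussianPDFReal]

/-- Integration against a pushforward under the reflection `x ↦ a - x`. -/
lemma integral_map_const_sub (a : ℝ) (ν : Measure ℝ) (f : ℝ → ℝ) :
    ∫ x, f x ∂(ν.map (fun x => a - x)) = ∫ x, f (a - x) ∂ν :=
  (MeasurableEquiv.subLeft a).measurableEmbedding.integral_map f

/-- symmetric `z`-test calibration.  In the Gaussian location model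
with known variance `v > 0`, margins `Δ⁻ < Δ⁺` and a mixing distribution `w` on
`(Δ⁻, Δ⁺)` that is symmetric around the midpoint `(Δ⁻ + Δ⁺)/2`, the boundary-mixture
likelihood ratio at `c = 1/2`,
`ε_{1/2}(x̄) = q(x̄) / (½ φ_v(x̄ - Δ⁻) + ½ φ_v(x̄ - Δ⁺))`,
has the same expectation under the two boundary Gaussians `N(Δ⁻, v)` and `N(Δ⁺, v)`. -/
theorem stmt17 (v : ℝ≥0) (hv : 0 < v) (Δm Δp : ℝ) (hΔ : Δm < Δp)
    (w : Measure ℝ) [IsProbabilityMeasure w]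
    (hw_supp : w (Set.Ioo Δm Δp)ᶜ = 0)
    (hw_symm : Measure.map (fun μ => (Δm + Δp) - μ) w = w)
    (q : ℝ → ℝ) (hq : ∀ x, q x = ∫ μ, gaussianPDFReal 0 v (x - μ) ∂w) :
    ∫ x, q x / ((1 / 2) * gaussianPDFReal 0 v (x - Δm) + (1 / 2) * gaussianPDFReal 0 v (x - Δp))
        ∂(gaussianReal Δm v)
      = ∫ x, q x / ((1 / 2) * gaussianPDFReal 0 v (x - Δm) + (1 / 2) * gaussianPDFReal 0 v (x - Δp))
        ∂(gaussianReal Δp v) := by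
  have hq_symm (x : ℝ) : q (Δm + Δp - x) = q x := by
    rw [hq, hq]
    nth_rewrite 1 [← hw_symm]
    rw [integral_map_const_sub]
    refine integral_congr_ae (.of_forall fun μ => ?_)
    dsimp only
    rw [← gaussianPDFReal_zero_neg v (x - μ)]
    congr 1
    ring
  have hgauss : gaussianReal Δp v = (gaussianReal Δm v).map (fun x => Δm + Δp - x) := by
    rw [gaussianReal_map_const_sub, add_sub_cancel_left]
  rw [hgauss, integral_map_const_sub]
  refine integral_congr_ae (.of_forall fun x => ?_)
  dsimp only
  rw [hq_symm, ← gaussianPDFReal_zero_neg v (x - Δm), ← gaussianPDFReal_zero_neg v (x - Δp)]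
  ring_nf
end

section
/- Let X = {1,2,3} and M = {1,2,3,4}, and define the probability mass functions p_μ on X by the matrix A = (1/24)·[[16,7,1],[12,6,6],[6,6,12],[2,4,18]], whose (μ,x) entry is p_μ(x). Then: (i) the family {p_μ : μ ∈ M} is STP₂, i.e. all entries are positive and for all μ_i < μ_j and x_k < x_l, p_{μ_i}(x_k)·p_{μ_j}(x_l) − p_{μ_i}(x_l)·p_{μ_j}(x_k) > 0; (ii) it is not STP₃, since the determinant of the 3×3 matrix with rows p_1, p_2, p_3 is negative; and (iii) there exists c* ∈ (0,1) with Σ_x p_1(x)·ε_{c*}(x) = Σ_x p_3(x)·ε_{c*}(x) = 1, where ε_c(x) := p_2(x)/(c·p_1(x) + (1−c)·p_3(x)), but Σ_x p_4(x)·ε_{c*}(x) > 1, so ε_{c*} is not a valid e-value for the composite null {p_1, p_3, p_4}. -/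
open scoped Matrix

/-- The family of pmfs on `X = {1,2,3}` indexed by `M = {1,2,3,4}`, given by the matrix
`A = (1/24)·[[16,7,1],[12,6,6],[6,6,12],[2,4,18]]` whose `(μ,x)` entry is `p_μ(x)`. -/
noncomputable def Apmf : Fin 4 → Fin 3 → ℝ := fun μ x =>
  (1 / 24) * (!![16, 7, 1; 12, 6, 6; 6, 6, 12; 2, 4, 18] : Matrix (Fin 4) (Fin 3) ℝ) μ x

theorem exists_root_Icc :
    ∃ c ∈ Set.Icc (0.558 : ℝ) 0.559, 279 - 438 * c - 110 * c ^ 2 = 0 := by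
  have hcont : ContinuousOn (fun c : ℝ => 279 - 438 * c - 110 * c ^ 2)
      (Set.Icc 0.558 0.559) := by fun_prop
  exact intermediate_value_Icc' (by norm_num) hcont (by constructor <;> norm_num)

/-- STP₂ does not imply STP₃: counterexample.
(i) The family `{p_μ}` is STP₂ (positive entries and positive `2×2` determinants);
(ii) it is not STP₃ (the `3×3` determinant with rows `p₁, p₂, p₃` is negative);
(iii) there is `c* ∈ (0,1)` such that `ε_{c*}(x) = p₂(x)/(c*·p₁(x) + (1-c*)·p₃(x))`
has expectation `1` under both `p₁` and `p₃`, but expectation `> 1` under `p₄`, so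
`ε_{c*}` is not a valid e-value for the composite null `{p₁, p₃, p₄}`.
(Indices `1,2,3,4` of the paper correspond to `0,1,2,3 : Fin 4`.) -/
theorem stmt18 :
    (∀ μ x, 0 < Apmf μ x) ∧
    (∀ μ₁ μ₂ : Fin 4, ∀ x₁ x₂ : Fin 3, μ₁ < μ₂ → x₁ < x₂ →
      0 < Apmf μ₁ x₁ * Apmf μ₂ x₂ - Apmf μ₁ x₂ * Apmf μ₂ x₁) ∧
    (Matrix.det !![Apmf 0 0, Apmf 0 1, Apmf 0 2;
                   Apmf 1 0, Apmf 1 1, Apmf 1 2;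
                   Apmf 2 0, Apmf 2 1, Apmf 2 2] < 0) ∧
    (∃ c : ℝ, c ∈ Set.Ioo (0 : ℝ) 1 ∧
      (∑ x : Fin 3, Apmf 0 x * (Apmf 1 x / (c * Apmf 0 x + (1 - c) * Apmf 2 x))) = 1 ∧
      (∑ x : Fin 3, Apmf 2 x * (Apmf 1 x / (c * Apmf 0 x + (1 - c) * Apmf 2 x))) = 1 ∧
      1 < ∑ x : Fin 3, Apmf 3 x * (Apmf 1 x / (c * Apmf 0 x + (1 - c) * Apmf 2 x))) := by
  refine ⟨?_, ?_, ?_, ?_⟩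
  · intro μ x
    fin_cases μ <;> fin_cases x <;> norm_num [Apmf]
  · intro μ₁ μ₂ x₁ x₂ hμ hx
    fin_cases μ₁ <;> fin_cases μ₂ <;> first
      | exact absurd hμ (by decide)
      | (fin_cases x₁ <;> fin_cases x₂ <;> first
          | exact absurd hx (by decide)
          | norm_num [Apmf])
  · simp [Matrix.det_fin_three, Apmf]
    norm_num
  · obtain ⟨c, ⟨hlo, hhi⟩, hroot⟩ := exists_root_Icc
    norm_num at hlo hhi
    have h₀ : 0 < 6 + 10 * c := by linarith
    have h₁ : 0 < 6 + c := by linarith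
    have h₂ : 0 < 12 - 11 * c := by linarith
    have hexp (μ : Fin 4) :
        ∑ x : Fin 3, Apmf μ x * (Apmf 1 x / (c * Apmf 0 x + (1 - c) * Apmf 2 x)) =
          Apmf μ 0 * (12 / (6 + 10 * c)) + Apmf μ 1 * (6 / (6 + c)) +
            Apmf μ 2 * (6 / (12 - 11 * c)) := by
      have e₀ : c * Apmf 0 0 + (1 - c) * Apmf 2 0 = (6 + 10 * c) / 24 := by
        simp [Apmf]; ring
      have e₁ : c * Apmf 0 1 + (1 - c) * Apmf 2 1 = (6 + c) / 24 := by
        simp [Apmf]; ring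
      have e₂ : c * Apmf 0 2 + (1 - c) * Apmf 2 2 = (12 - 11 * c) / 24 := by
        simp [Apmf]; ring
      have n₀ : Apmf 1 0 = 12 / 24 := by norm_num [Apmf]
      have n₁ : Apmf 1 1 = 6 / 24 := by norm_num [Apmf]
      have n₂ : Apmf 1 2 = 6 / 24 := by simp [Apmf]; ring
      rw [Fin.sum_univ_three, e₀, e₁, e₂, n₀, n₁, n₂]
      simp only [div_div_div_cancel_right₀ (by norm_num : (24 : ℝ) ≠ 0)]
    refine ⟨c, ⟨by linarith, by linarith⟩, ?_, ?_, ?_⟩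
    · rw [hexp]
      simp [Apmf]
      have h₂' : 12 - c * 11 ≠ 0 := by rw [mul_comm]; exact h₂.ne'
      field_simp
      linear_combination (24 * (1 - c)) * hroot
    · rw [hexp]
      simp [Apmf]
      have h₂' : 12 - c * 11 ≠ 0 := by rw [mul_comm]; exact h₂.ne'
      field_simp
      linear_combination (-24 * c) * hroot
    · rw [hexp]
      have b₀ : 12 / 11.59 ≤ 12 / (6 + 10 * c) := by gcongr; linarith
      have b₁ : 6 / 6.559 ≤ 6 / (6 + c) := by gcongr; linarith
      have b₂ : 6 / 5.862 ≤ 6 / (12 - 11 * c) := by gcongr; linarith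
      norm_num at b₀ b₁ b₂
      simp [Apmf]
      linarith
end
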